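/- Let β, r ∈ (0,∞), q ∈ ℕ ∪ {0}, and d, d⋆, d*, K ∈ ℕ with d* ≤ min{d, K + 1{q=0}·(d−K)}. There exists a constant E₇ ∈ (0,∞) depending only on (d*,β,r,q) such that for every f ∈ G^CHOM_d(q,K,d⋆,d*,β,r) and every ε ∈ (0,1/2] there exists f̃ ∈ F^FNN_d( (q+1)·(3·log d⋆ + E₇·log(1/ε)), 2K·d⋆ + K·E₇·ε^(−d*/(β·(min{1,β})^q)), (K·q+1)·(63·d⋆ + E₇·ε^(−d*/(β·(min{1,β})^q))·log(1/ε)), 1, ∞ ) such that sup_{x ∈ [0,1]^d} |f(x) − f̃(x)| ≤ ε/8. -/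

import Mathlib

open MeasureTheory
open scoped ENNReal NNReal

namespace DNNLogistic

noncomputable section

/-- The unit cube `[0,1]^d` as a subset of `ℝ^d`. -/
def cube (d : ℕ) : Set (Fin d → ℝ) := {x | ∀ i, x i ∈ Set.Icc (0 : ℝ) 1}

/-- The logistic loss `φ(t) = log (1 + e^{-t})`. -/
def logLoss (t : ℝ) : ℝ := Real.log (1 + Real.exp (-t))

/-- `sgn(t) = 1` if `t ≥ 0`, `sgn(t) = -1` otherwise. -/
def rsgn (t : ℝ) : ℝ := if 0 ≤ t then 1 else -1

/-- The Euclidean distance `‖x - z‖₂` on `ℝ^m`. -/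
def eucDist {m : ℕ} (x z : Fin m → ℝ) : ℝ := Real.sqrt (∑ i, (x i - z i) ^ 2)

/-- The logistic risk `R^φ_{η,Q}(f)` of `f` with respect to the conditional probability
function `η` and the marginal distribution `Q` on `[0,1]^d`. -/
def logRisk (d : ℕ) (Q : Measure (Fin d → ℝ)) (η f : (Fin d → ℝ) → ℝ) : ℝ :=
  ∫ x, (η x * logLoss (f x) + (1 - η x) * logLoss (-f x)) ∂Q

/-- The infimum of the logistic risk over all Borel measurable real-valued functions. -/
def infLogRisk (d : ℕ) (Q : Measure (Fin d → ℝ)) (η : (Fin d → ℝ) → ℝ) : ℝ :=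
  sInf {t | ∃ g : (Fin d → ℝ) → ℝ, Measurable g ∧ t = logRisk d Q η g}

/-- The excess logistic risk `E^φ_{η,Q}(f)`. -/
def excessLogRisk (d : ℕ) (Q : Measure (Fin d → ℝ)) (η f : (Fin d → ℝ) → ℝ) : ℝ :=
  logRisk d Q η f - infLogRisk d Q η

/-- The misclassification risk `R_{η,Q}(f)`; note `1{sgn(f x) = -1} = 1{f x < 0}` and
`1{sgn(f x) = 1} = 1{0 ≤ f x}`. -/
def misRisk (d : ℕ) (Q : Measure (Fin d → ℝ)) (η f : (Fin d → ℝ) → ℝ) : ℝ :=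
  ∫ x, (η x * (if f x < 0 then (1 : ℝ) else 0)
      + (1 - η x) * (if 0 ≤ f x then (1 : ℝ) else 0)) ∂Q

/-- The infimum of the misclassification risk over all Borel measurable functions. -/
def infMisRisk (d : ℕ) (Q : Measure (Fin d → ℝ)) (η : (Fin d → ℝ) → ℝ) : ℝ :=
  sInf {t | ∃ g : (Fin d → ℝ) → ℝ, Measurable g ∧ t = misRisk d Q η g}

/-- The excess misclassification error `E_{η,Q}(f)`. -/
def excessMisRisk (d : ℕ) (Q : Measure (Fin d → ℝ)) (η f : (Fin d → ℝ) → ℝ) : ℝ :=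
  misRisk d Q η f - infMisRisk d Q η

/-- The joint distribution `P_{η,Q}` on `ℝ^d × ℝ`: the marginal on the first factor is `Q`,
and the conditional distribution of the label given `x` puts mass `η x` on `1` and mass
`1 - η x` on `-1`.  It satisfies `P_{η,Q}(S) = ∫ (η x • 1_S(x,1) + (1 - η x) • 1_S(x,-1)) dQ`. -/
def PeQ (d : ℕ) (Q : Measure (Fin d → ℝ)) (η : (Fin d → ℝ) → ℝ) :
    Measure ((Fin d → ℝ) × ℝ) :=
  (Q.withDensity fun x => ENNReal.ofReal (η x)).map (fun x => (x, (1 : ℝ)))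
    + (Q.withDensity fun x => ENNReal.ofReal (1 - η x)).map (fun x => (x, (-1 : ℝ)))

/-- The logistic risk `R^φ_P(f)` with respect to a joint distribution `P` on
`[0,1]^d × {-1,1}`. -/
def jointLogRisk (d : ℕ) (P : Measure ((Fin d → ℝ) × ℝ)) (f : (Fin d → ℝ) → ℝ) : ℝ :=
  ∫ z, logLoss (z.2 * f z.1) ∂P

/-- The Lebesgue measure on the cube `[0,1]^d`. -/
def cubeVolume (d : ℕ) : Measure (Fin d → ℝ) := volume.restrict (cube d)

/-- The `n`-fold product measure `P^{⊗n}` on the sample space. -/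
def nSample (d n : ℕ) (P : Measure ((Fin d → ℝ) × ℝ)) :
    Measure (Fin n → (Fin d → ℝ) × ℝ) :=
  Measure.pi fun _ => P

/-- `fhat` is an empirical logistic-risk minimizer over the class `Fcls` from samples of
size `n`: it is jointly Borel measurable, and for every sample
`z ∈ ([0,1]^d × {-1,1})^n` the function `fhat z` belongs to `Fcls` and minimizes the
empirical logistic risk over `Fcls`. -/
def IsERM (d n : ℕ) (Fcls : Set ((Fin d → ℝ) → ℝ))
    (fhat : (Fin n → (Fin d → ℝ) × ℝ) → (Fin d → ℝ) → ℝ) : Prop :=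
  Measurable (fun p : (Fin n → (Fin d → ℝ) × ℝ) × (Fin d → ℝ) => fhat p.1 p.2) ∧
  ∀ z : Fin n → (Fin d → ℝ) × ℝ, (∀ i, z i ∈ (cube d) ×ˢ ({-1, 1} : Set ℝ)) →
    fhat z ∈ Fcls ∧
    ∀ f ∈ Fcls,
      ∑ i, logLoss ((z i).2 * fhat z ((z i).1)) ≤ ∑ i, logLoss ((z i).2 * f ((z i).1))

/-- The successive hidden layers of a fully connected ReLU network:
`u₀ = x` and `u_{k+1} = σ_{v_{k+1}}(W_k u_k)`. -/
def fnnHidden (m : ℕ → ℕ) (W : ∀ k : ℕ, Matrix (Fin (m (k + 1))) (Fin (m k)) ℝ)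
    (v : ∀ k : ℕ, Fin (m k) → ℝ) : (k : ℕ) → (Fin (m 0) → ℝ) → (Fin (m k) → ℝ)
  | 0 => fun x => x
  | (k + 1) => fun x j => max ((W k).mulVec (fnnHidden m W v k x) j - v (k + 1) j) 0

/-- `f ∈ F^FNN_d(G, N, S, B, F)`: `f : ℝ^d → ℝ` is realized by a fully connected ReLU
network `x ↦ W_L σ_{v_L} W_{L-1} ⋯ W_1 σ_{v_1} W_0 x` with depth `L ≤ G`, hidden widths
at most `N`, at most `S` nonzero entries among all weight matrices and bias vectors, all
entries bounded by `B` in absolute value, and `sup_{x ∈ [0,1]^d} |f x| ≤ F`. -/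
def IsFNN (d : ℕ) (G N S B : ℝ) (F : ℝ≥0∞) (f : (Fin d → ℝ) → ℝ) : Prop :=
  ∃ (L : ℕ) (m : ℕ → ℕ) (W : ∀ k : ℕ, Matrix (Fin (m (k + 1))) (Fin (m k)) ℝ)
    (v : ∀ k : ℕ, Fin (m k) → ℝ) (hm0 : m 0 = d) (hmL : m (L + 1) = 1),
    1 ≤ L ∧ (L : ℝ) ≤ G ∧
    (∀ k : ℕ, 1 ≤ k → k ≤ L → (m k : ℝ) ≤ N) ∧
    (((∑ k ∈ Finset.range (L + 1),
          Set.ncard {p : Fin (m (k + 1)) × Fin (m k) | W k p.1 p.2 ≠ 0}) +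
        (∑ k ∈ Finset.Icc 1 L, Set.ncard {j : Fin (m k) | v k j ≠ 0}) : ℝ) ≤ S) ∧
    (∀ k : ℕ, k ≤ L → ∀ i j, |W k i j| ≤ B) ∧
    (∀ k : ℕ, 1 ≤ k → k ≤ L → ∀ j, |v k j| ≤ B) ∧
    (∀ x ∈ cube d, ENNReal.ofReal |f x| ≤ F) ∧
    (∀ x : Fin d → ℝ,
      f x = (W L).mulVec (fnnHidden m W v L fun i => x (Fin.cast hm0 i)) (Fin.cast hmL.symm 0))

/-- The partial derivative (within the cube) of `f` in the `i`-th coordinate direction. -/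
def pderivW (m : ℕ) (i : Fin m) (f : (Fin m → ℝ) → ℝ) : (Fin m → ℝ) → ℝ :=
  fun x => fderivWithin ℝ f (cube m) x (Pi.single i 1)

/-- The iterated partial derivative of `f` along the list of coordinate directions `l`. -/
def derivListW (m : ℕ) : List (Fin m) → ((Fin m → ℝ) → ℝ) → ((Fin m → ℝ) → ℝ)
  | [], f => f
  | (i :: l), f => derivListW m l (pderivW m i f)

/-- Membership in the Hölder ball `B^β_r([0,1]^m)`: with `k = ⌈β⌉ - 1` and
`λ = β - ⌈β⌉ + 1`, `f` has continuous partial derivatives (within the cube) up to order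
`k`, and the maximum of the sup-norms of its derivatives of order at most `k` plus the
maximum of the Hölder-`λ` seminorms of its derivatives of order `k` is at most `r`. -/
def MemHolderBall (m : ℕ) (β r : ℝ) (f : (Fin m → ℝ) → ℝ) : Prop :=
  (∀ l : List (Fin m), l.length < ⌈β⌉₊ - 1 →
    DifferentiableOn ℝ (derivListW m l f) (cube m)) ∧
  (∀ l : List (Fin m), l.length ≤ ⌈β⌉₊ - 1 →
    ContinuousOn (derivListW m l f) (cube m)) ∧
  ∃ A Bc : ℝ, A + Bc ≤ r ∧
    (∀ l : List (Fin m), l.length ≤ ⌈β⌉₊ - 1 → ∀ x ∈ cube m, |derivListW m l f x| ≤ A) ∧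
    (∀ l : List (Fin m), l.length = ⌈β⌉₊ - 1 → ∀ x ∈ cube m, ∀ z ∈ cube m, x ≠ z →
      |derivListW m l f x - derivListW m l f z| ≤ Bc * eucDist x z ^ (β - (⌈β⌉₊ : ℝ) + 1))

/-- `f ∈ G^M_d(dmax)`: on `[0,1]^d`, `f` computes the maximum of at most `dmax` of its
input coordinates. -/
def GM (d dmax : ℕ) (f : (Fin d → ℝ) → ℝ) : Prop :=
  ∃ (I : Finset (Fin d)) (hI : I.Nonempty), I.card ≤ dmax ∧
    ∀ x ∈ cube d, f x = I.sup' hI fun i => x i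

/-- `f ∈ G^H_d(dstar, β, r)`: on `[0,1]^d`, `f` depends on exactly `dstar` of its input
coordinates, through a function in the Hölder ball `B^β_r([0,1]^{dstar})`. -/
def GH (d dstar : ℕ) (β r : ℝ) (f : (Fin d → ℝ) → ℝ) : Prop :=
  ∃ (I : Finset (Fin d)) (hI : I.card = dstar) (g : (Fin dstar → ℝ) → ℝ),
    MemHolderBall dstar β r g ∧
    ∀ x ∈ cube d, f x = g fun j => x ↑(I.orderIsoOfFin hI j)

/-- Iterated composition `h_{n-1} ∘ ⋯ ∘ h_1 ∘ h_0` of a chain of maps with varying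
dimensions `D : ℕ → ℕ`. -/
def depChain (D : ℕ → ℕ) (h : ∀ i : ℕ, (Fin (D i) → ℝ) → (Fin (D (i + 1)) → ℝ)) :
    (n : ℕ) → (Fin (D 0) → ℝ) → (Fin (D n) → ℝ)
  | 0 => fun x => x
  | (n + 1) => fun x => h n (depChain D h n x)

/-- `f ∈ G^CHOM_d(q, K, dmax, dstar, β, r)`: on `[0,1]^d`, `f` is a composition
`h_q ∘ ⋯ ∘ h_0` where `h_0 : [0,1]^d → [0,1]^K`, `h_i : [0,1]^K → [0,1]^K` for
`0 < i < q`, `h_q : [0,1]^{d or K} → ℝ`, and each coordinate function of each `h_i`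
belongs to `G^H(dstar, β, r) ∪ G^M(dmax)`. -/
def GCHOM (q d dmax dstar K : ℕ) (β r : ℝ) (f : (Fin d → ℝ) → ℝ) : Prop :=
  ∃ (D : ℕ → ℕ) (h : ∀ i : ℕ, (Fin (D i) → ℝ) → (Fin (D (i + 1)) → ℝ))
    (hD0 : D 0 = d) (hDq : D (q + 1) = 1),
    (∀ i : ℕ, 1 ≤ i → i ≤ q → D i = K) ∧
    (∀ i : ℕ, i ≤ q → ∀ j : Fin (D (i + 1)),
      GH (D i) dstar β r (fun x => h i x j) ∨ GM (D i) dmax (fun x => h i x j)) ∧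
    (∀ i : ℕ, i < q → ∀ x ∈ cube (D i), h i x ∈ cube (D (i + 1))) ∧
    (∀ x ∈ cube d,
      f x = depChain D h (q + 1) (fun i => x (Fin.cast hD0 i)) (Fin.cast hDq.symm 0))

/-- `f ∈ G^CH_d(q, K, dstar, β, r)`: as `G^CHOM`, but every coordinate function belongs
to `G^H(dstar, β, r)`. -/
def GCH (q d dstar K : ℕ) (β r : ℝ) (f : (Fin d → ℝ) → ℝ) : Prop :=
  ∃ (D : ℕ → ℕ) (h : ∀ i : ℕ, (Fin (D i) → ℝ) → (Fin (D (i + 1)) → ℝ))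
    (hD0 : D 0 = d) (hDq : D (q + 1) = 1),
    (∀ i : ℕ, 1 ≤ i → i ≤ q → D i = K) ∧
    (∀ i : ℕ, i ≤ q → ∀ j : Fin (D (i + 1)), GH (D i) dstar β r (fun x => h i x j)) ∧
    (∀ i : ℕ, i < q → ∀ x ∈ cube (D i), h i x ∈ cube (D (i + 1))) ∧
    (∀ x ∈ cube d,
      f x = depChain D h (q + 1) (fun i => x (Fin.cast hD0 i)) (Fin.cast hDq.symm 0))

/-- The sup-norm over the cube of the (componentwise) difference of two vector-valued
functions. -/
def supDiffVec (m k : ℕ) (g g' : (Fin m → ℝ) → (Fin k → ℝ)) : ℝ :=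
  sSup {t | ∃ x ∈ cube m, ∃ j : Fin k, t = |g x j - g' x j|}

/-- The binary entropy function `H`. -/
def entH (t : ℝ) : ℝ :=
  if t = 0 ∨ t = 1 then 0 else t * Real.log (1 / t) + (1 - t) * Real.log (1 / (1 - t))

/-- `sup { 1/(2(2 + e^t + e^{-t})) : min u v ≤ t ≤ max u v }`. -/
def wSup (u v : ℝ) : ℝ :=
  sSup {s | ∃ t ∈ Set.Icc (min u v) (max u v), s = 1 / (2 * (2 + Real.exp t + Real.exp (-t)))}

/-- The function `J` of Statement 19. -/
def Jfun (x y : ℝ) : ℝ :=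
  (x + y) * Real.log (2 / (x + y)) + (2 - x - y) * Real.log (2 / (2 - x - y))
    - (x * Real.log (1 / x) + (1 - x) * Real.log (1 / (1 - x))
        + y * Real.log (1 / y) + (1 - y) * Real.log (1 / (1 - y)))

/-- The grid `G_{Q,d}` of points of `[0,1]^d` whose coordinates are odd multiples of
`1/(2Q)`. -/
def oddGrid (d Qn : ℕ) : Set (Fin d → ℝ) :=
  {a | a ∈ cube d ∧ ∀ i, ∃ k : ℤ, Odd k ∧ a i = (k : ℝ) / (2 * (Qn : ℝ))}

/-! ### Networks ending with a ReLU layer -/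

/-- Indicator of being nonzero. -/
def nz (x : ℝ) : ℕ := if x = 0 then 0 else 1

lemma nz_zero : nz 0 = 0 := by simp [nz]

lemma nz_le_one (x : ℝ) : nz x ≤ 1 := by unfold nz; split_ifs <;> simp

/-- One ReLU layer with weights bounded by one and at most `s` nonzero parameters. -/
def Lay (s : ℕ) (ι κ : Type) [Fintype ι] [Fintype κ] (F : (ι → ℝ) → κ → ℝ) : Prop :=
  ∃ (W : κ → ι → ℝ) (v : κ → ℝ), (∀ j i, |W j i| ≤ 1) ∧ (∀ j, |v j| ≤ 1) ∧
    (∑ j, ∑ i, nz (W j i)) + (∑ j, nz (v j)) ≤ s ∧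
    ∀ x j, F x j = max (∑ i, W j i * x i - v j) 0

/-- A composition of `L` ReLU layers of widths at most `w`, with at most `s` nonzero
parameters. -/
def Net (w : ℕ) : (L : ℕ) → (s : ℕ) → (ι κ : Type) → [Fintype ι] → [Fintype κ] →
    ((ι → ℝ) → κ → ℝ) → Prop
  | 0, _, ι, κ, _, _, F => ∃ e : κ ≃ ι, ∀ x k, F x k = x (e k)
  | (L + 1), s, ι, κ, _, _, F => ∃ (μ : Type) (_ : Fintype μ) (s₁ s₂ : ℕ)
      (G : (ι → ℝ) → μ → ℝ) (H : (μ → ℝ) → κ → ℝ), Lay s₁ ι μ G ∧ Fintype.card μ ≤ w ∧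
      Net w L s₂ μ κ H ∧ (∀ x, F x = H (G x)) ∧ s₁ + s₂ ≤ s

lemma Net.mono {w w' : ℕ} (hw : w ≤ w') : ∀ {L s s' : ℕ} {ι κ : Type} [Fintype ι] [Fintype κ]
    {F : (ι → ℝ) → κ → ℝ}, s ≤ s' → Net w L s ι κ F → Net w' L s' ι κ F := by
  intro L
  induction L with
  | zero => intro s s' ι κ _ _ F _ h; exact h
  | succ L ih =>
    intro s s' ι κ _ _ F hs h
    obtain ⟨μ, _, s₁, s₂, G, H, h1, h2, h3, h4, h5⟩ := h
    exact ⟨μ, _, s₁, s₂, G, H, h1, h2.trans hw, ih le_rfl h3, h4, h5.trans hs⟩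

lemma Net.congr {w L s : ℕ} {ι κ : Type} [Fintype ι] [Fintype κ]
    {F F' : (ι → ℝ) → κ → ℝ} (h : Net w L s ι κ F) (hF : ∀ x k, F x k = F' x k) :
    Net w L s ι κ F' := by
  have : F = F' := by funext x k; exact hF x k
  rwa [← this]

lemma Lay.comp_equiv {s : ℕ} {ι ι' κ : Type} [Fintype ι] [Fintype ι'] [Fintype κ]
    {F : (ι → ℝ) → κ → ℝ} (e : ι ≃ ι') (h : Lay s ι κ F) :
    Lay s ι' κ (fun x => F (fun i => x (e i))) := by
  obtain ⟨W, v, hW, hv, hs, hF⟩ := h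
  refine ⟨fun j i => W j (e.symm i), v, fun j i => hW _ _, hv, ?_, ?_⟩
  · refine le_trans (le_of_eq ?_) hs
    congr 1
    refine Finset.sum_congr rfl fun j _ => ?_
    exact Equiv.sum_comp e.symm (fun i => nz (W j i))
  · intro x j
    beta_reduce
    rw [hF]
    congr 2
    rw [← Equiv.sum_comp e]
    simp

lemma Net.comp_equiv {w L s : ℕ} {ι ι' κ : Type} [Fintype ι] [Fintype ι'] [Fintype κ]
    {F : (ι → ℝ) → κ → ℝ} (e : ι ≃ ι') (h : Net w L s ι κ F) :
    Net w L s ι' κ (fun x => F (fun i => x (e i))) := by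
  cases L with
  | zero =>
    obtain ⟨e', he⟩ := h
    exact ⟨e'.trans e, fun x k => by simp [he]⟩
  | succ L =>
    obtain ⟨μ, _, s₁, s₂, G, H, h1, h2, h3, h4, h5⟩ := h
    exact ⟨μ, _, s₁, s₂, _, H, h1.comp_equiv e, h2, h3, fun x => h4 _, h5⟩

lemma Net.comp {w : ℕ} : ∀ {L₁ L₂ s₁ s₂ : ℕ} {ι κ μ : Type} [Fintype ι] [Fintype κ]
    [Fintype μ] {F : (ι → ℝ) → κ → ℝ} {G : (κ → ℝ) → μ → ℝ},
    Net w L₁ s₁ ι κ F → Net w L₂ s₂ κ μ G →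
    Net w (L₁ + L₂) (s₁ + s₂) ι μ (fun x => G (F x)) := by
  intro L₁
  induction L₁ with
  | zero =>
    intro L₂ s₁ s₂ ι κ μ _ _ _ F G h1 h2
    obtain ⟨e, he⟩ := h1
    rw [Nat.zero_add]
    refine Net.congr ((h2.comp_equiv e).mono le_rfl (Nat.le_add_left _ _)) ?_
    intro x k
    have : F x = fun i => x (e i) := by funext i; exact he x i
    rw [this]
  | succ L ih =>
    intro L₂ s₁ s₂ ι κ μ _ _ _ F G h1 h2
    obtain ⟨μ', _, t₁, t₂, A, B, k1, k2, k3, k4, k5⟩ := h1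
    rw [Nat.add_right_comm]
    refine ⟨μ', _, t₁, t₂ + s₂, A, fun y => G (B y), k1, k2, ih k3 h2, ?_, by omega⟩
    intro x
    beta_reduce
    rw [k4]

lemma Lay.net {w s : ℕ} {ι κ : Type} [Fintype ι] [Fintype κ] {F : (ι → ℝ) → κ → ℝ}
    (h : Lay s ι κ F) (hw : Fintype.card κ ≤ w) : Net w 1 s ι κ F :=
  ⟨κ, _, s, 0, F, fun y => y, h, hw, ⟨Equiv.refl _, fun _ _ => rfl⟩, fun _ => rfl, le_rfl⟩

/-- Stack layers acting on embedded parts of a common input. -/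
lemma Lay.stack {A : Type} [Fintype A] {ι' : Type} [Fintype ι'] {ι κ : A → Type}
    [∀ a, Fintype (ι a)] [∀ a, Fintype (κ a)] {s : A → ℕ}
    {F : ∀ a, (ι a → ℝ) → κ a → ℝ} (h : ∀ a, Lay (s a) (ι a) (κ a) (F a))
    (e : ∀ a, ι a → ι') (he : ∀ a, Function.Injective (e a)) :
    Lay (∑ a, s a) ι' (Σ a, κ a) (fun x p => F p.1 (fun i => x (e p.1 i)) p.2) := by
  choose W v hW hv hs hF using h
  refine ⟨fun p => Function.extend (e p.1) (W p.1 p.2) 0, fun p => v p.1 p.2, ?_, ?_, ?_, ?_⟩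
  · rintro ⟨a, j⟩ i
    by_cases hi : ∃ i', e a i' = i
    · obtain ⟨i', rfl⟩ := hi
      simp only
      rw [(he a).extend_apply]
      exact hW _ _ _
    · simp only
      rw [Function.extend_apply' _ _ _ hi]
      simp
  · rintro ⟨a, j⟩
    exact hv _ _
  · rw [Fintype.sum_sigma, Fintype.sum_sigma, ← Finset.sum_add_distrib]
    refine Finset.sum_le_sum fun a _ => le_trans (le_of_eq ?_) (hs a)
    congr 1
    refine Finset.sum_congr rfl fun j _ => ?_
    symm
    refine Fintype.sum_of_injective (e a) (he a) _ _ ?_ ?_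
    · intro i hi
      simp only
      rw [Function.extend_apply' _ _ _ (by simpa using hi)]
      simp [nz]
    · intro i
      simp only
      rw [(he a).extend_apply]
  · rintro x ⟨a, j⟩
    simp only
    rw [hF]
    congr 2
    refine Fintype.sum_of_injective (e a) (he a) _ _ ?_ ?_
    · intro i hi
      rw [Function.extend_apply' _ _ _ (by simpa using hi)]
      simp
    · intro i
      rw [(he a).extend_apply]

lemma Net.parBlock {A : Type} [Fintype A] {w : A → ℕ} : ∀ {L : ℕ} {s : A → ℕ}
    {ι κ : A → Type} [∀ a, Fintype (ι a)] [∀ a, Fintype (κ a)]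
    {F : ∀ a, (ι a → ℝ) → κ a → ℝ}, (∀ a, Net (w a) L (s a) (ι a) (κ a) (F a)) →
    Net (∑ a, w a) L (∑ a, s a) (Σ a, ι a) (Σ a, κ a)
      (fun x p => F p.1 (fun i => x ⟨p.1, i⟩) p.2) := by
  intro L
  induction L with
  | zero =>
    intro s ι κ _ _ F h
    choose e he using h
    exact ⟨Equiv.sigmaCongrRight e, fun x ⟨a, j⟩ => by simp [he]⟩
  | succ L ih =>
    intro s ι κ _ _ F h
    choose μ iμ s₁ s₂ G H h1 h2 h3 h4 h5 using h
    refine ⟨Σ a, μ a, inferInstance, ∑ a, s₁ a, ∑ a, s₂ a,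
      fun x p => G p.1 (fun i => x ⟨p.1, i⟩) p.2, fun x p => H p.1 (fun i => x ⟨p.1, i⟩) p.2,
      ?_, ?_, ih h3, ?_, ?_⟩
    · exact Lay.stack h1 (fun a i => (⟨a, i⟩ : Σ a, ι a)) (fun a => sigma_mk_injective)
    · rw [Fintype.card_sigma]
      exact Finset.sum_le_sum fun a _ => h2 a
    · intro x
      funext p
      beta_reduce
      rw [h4]
    · rw [← Finset.sum_add_distrib]
      exact Finset.sum_le_sum fun a _ => h5 a

lemma Net.par {A : Type} [Fintype A] {w : A → ℕ} {L : ℕ} (hL : 1 ≤ L) {s : A → ℕ}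
    {ι : Type} {κ : A → Type} [Fintype ι] [∀ a, Fintype (κ a)]
    {F : ∀ a, (ι → ℝ) → κ a → ℝ} (h : ∀ a, Net (w a) L (s a) ι (κ a) (F a)) :
    Net (∑ a, w a) L (∑ a, s a) ι (Σ a, κ a) (fun x p => F p.1 x p.2) := by
  obtain ⟨L, rfl⟩ : ∃ L', L = L' + 1 := ⟨L - 1, by omega⟩
  choose μ iμ s₁ s₂ G H h1 h2 h3 h4 h5 using h
  refine ⟨Σ a, μ a, inferInstance, ∑ a, s₁ a, ∑ a, s₂ a,
      fun x p => G p.1 x p.2, fun x p => H p.1 (fun i => x ⟨p.1, i⟩) p.2,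
      ?_, ?_, Net.parBlock h3, ?_, ?_⟩
  · exact Lay.stack h1 (fun a i => i) (fun a => Function.injective_id)
  · rw [Fintype.card_sigma]
    exact Finset.sum_le_sum fun a _ => h2 a
  · intro x
    funext p
    beta_reduce
    rw [h4]
  · rw [← Finset.sum_add_distrib]
    exact Finset.sum_le_sum fun a _ => h5 a

/-- Networks with one output. -/
def SNet (w L s : ℕ) (ι : Type) [Fintype ι] (f : (ι → ℝ) → ℝ) : Prop :=
  Net w L s ι Unit (fun x _ => f x)

lemma SNet.mono {w w' L s s' : ℕ} {ι : Type} [Fintype ι] {f : (ι → ℝ) → ℝ}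
    (h : SNet w L s ι f) (hw : w ≤ w') (hs : s ≤ s') : SNet w' L s' ι f :=
  Net.mono hw hs h

lemma SNet.par {A : Type} [Fintype A] {w : A → ℕ} {L : ℕ} (hL : 1 ≤ L) {s : A → ℕ}
    {ι : Type} [Fintype ι] {f : A → (ι → ℝ) → ℝ} (h : ∀ a, SNet (w a) L (s a) ι (f a)) :
    Net (∑ a, w a) L (∑ a, s a) ι A (fun x a => f a x) := by
  have h1 := Net.par hL h
  have h2 : Net (∑ a, w a) 0 0 (Σ _ : A, Unit) A (fun y a => y ⟨a, ()⟩) :=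
    ⟨⟨fun a => ⟨a, ()⟩, fun p => p.1, fun _ => rfl, fun _ => rfl⟩, fun _ _ => rfl⟩
  exact h1.comp h2

/-- A network with scalar output after a vector network. -/
lemma Net.scomp {w L₁ L₂ s₁ s₂ : ℕ} {ι κ : Type} [Fintype ι] [Fintype κ]
    {F : (ι → ℝ) → κ → ℝ} {g : (κ → ℝ) → ℝ} (h1 : Net w L₁ s₁ ι κ F)
    (h2 : SNet w L₂ s₂ κ g) : SNet w (L₁ + L₂) (s₁ + s₂) ι (fun x => g (F x)) :=
  h1.comp h2

lemma SNet.then {w L₁ L₂ s₁ s₂ : ℕ} {ι : Type} [Fintype ι]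
    {f : (ι → ℝ) → ℝ} {g : (Unit → ℝ) → ℝ} (h1 : SNet w L₁ s₁ ι f)
    (h2 : SNet w L₂ s₂ Unit g) :
    SNet w (L₁ + L₂) (s₁ + s₂) ι (fun x => g (fun _ => f x)) :=
  h1.comp h2

/-- A single neuron. -/
lemma SNet.neuron {ι : Type} [Fintype ι] (c : ι → ℝ) (b : ℝ) (hc : ∀ i, |c i| ≤ 1)
    (hb : |b| ≤ 1) {w : ℕ} (hw : 1 ≤ w) :
    SNet w 1 (Fintype.card ι + 1) ι (fun x => max (∑ i, c i * x i - b) 0) := by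
  refine Lay.net (s := Fintype.card ι + 1) ⟨fun _ => c, fun _ => b, fun _ => hc, fun _ => hb, ?_,
    fun _ _ => rfl⟩ (by simpa using hw)
  simp only [Finset.univ_unique, Finset.sum_singleton]
  refine Nat.add_le_add ?_ (nz_le_one _)
  calc ∑ i, nz (c i) ≤ ∑ _i : ι, 1 := Finset.sum_le_sum fun i _ => nz_le_one _
    _ = _ := by simp

/-- A single neuron without bias. -/
lemma SNet.neuron0 {ι : Type} [Fintype ι] (c : ι → ℝ) (hc : ∀ i, |c i| ≤ 1)
    {w : ℕ} (hw : 1 ≤ w) :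
    SNet w 1 (Fintype.card ι) ι (fun x => max (∑ i, c i * x i) 0) := by
  refine Lay.net (s := Fintype.card ι) ⟨fun _ => c, fun _ => 0, fun _ => hc, by simp, ?_,
    fun _ _ => by simp⟩ (by simpa using hw)
  simp only [Finset.univ_unique, Finset.sum_singleton, nz_zero, add_zero]
  calc ∑ i, nz (c i) ≤ ∑ _i : ι, 1 := Finset.sum_le_sum fun i _ => nz_le_one _
    _ = _ := by simp

/-- A general layer, with the trivial count of parameters. -/
lemma Net.layer {ι κ : Type} [Fintype ι] [Fintype κ] (W : κ → ι → ℝ) (b : κ → ℝ)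
    (hW : ∀ j i, |W j i| ≤ 1)
    (hb : ∀ j, |b j| ≤ 1) {w : ℕ} (hw : Fintype.card κ ≤ w) :
    Net w 1 (Fintype.card κ * (Fintype.card ι + 1)) ι κ
      (fun x j => max (∑ i, W j i * x i - b j) 0) := by
  refine Lay.net ⟨W, b, hW, hb, ?_, fun _ _ => rfl⟩ hw
  rw [← Finset.sum_add_distrib]
  calc ∑ j, (∑ i, nz (W j i) + nz (b j)) ≤ ∑ _j : κ, (∑ _i : ι, 1 + 1) := by
        gcongr <;> exact nz_le_one _
    _ = _ := by simp

/-- Selecting coordinates (with a ReLU). -/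
lemma Net.copy {ι κ : Type} [Fintype ι] [Fintype κ] (e : κ → ι) {w : ℕ}
    (hw : Fintype.card κ ≤ w) :
    Net w 1 (Fintype.card κ) ι κ (fun x j => max (x (e j)) 0) := by
  classical
  refine Lay.net ⟨fun j i => if i = e j then 1 else 0, fun _ => 0, ?_, by simp, ?_, ?_⟩ hw
  · intro j i
    beta_reduce
    split_ifs <;> simp
  · simp only [nz_zero, Finset.sum_const_zero, add_zero]
    have : ∀ j : κ, ∑ i, nz (if i = e j then (1 : ℝ) else 0) = 1 := by
      intro j
      have : ∀ i, nz (if i = e j then (1 : ℝ) else 0) = if i = e j then 1 else 0 := by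
        intro i; split_ifs <;> simp [nz]
      simp [this]
    simp [this]
  · intro x j
    simp

/-- Adding identity layers. -/
lemma SNet.pad {w L s : ℕ} {ι : Type} [Fintype ι] {f : (ι → ℝ) → ℝ} (h : SNet w L s ι f)
    (hw : 1 ≤ w) (hf : ∀ x, 0 ≤ f x) (n : ℕ) : SNet w (L + n) (s + n) ι f := by
  induction n with
  | zero => exact h
  | succ n ih =>
    have := ih.then (SNet.neuron0 (ι := Unit) (fun _ => 1) (by simp) hw)
    have h2 : (fun x => max (∑ i : Unit, (fun _ => (1 : ℝ)) i * (fun _ : Unit => f x) i) 0)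
        = f := by
      funext x; simp [hf x]
    rw [h2] at this
    simpa [add_assoc] using this

/-- The zero network. -/
lemma SNet.zero {ι : Type} [Fintype ι] {w : ℕ} (hw : 1 ≤ w) (L : ℕ) :
    SNet w (L + 1) 0 ι (fun _ => 0) := by
  have h0 : ∀ (κ : Type) [Fintype κ], SNet w 1 0 κ (fun _ => 0) := by
    intro κ _
    refine Lay.net (s := 0) ⟨fun _ _ => 0, fun _ => 0, by simp, by simp, by simp [nz_zero],
      fun _ _ => by simp⟩ (by simpa using hw)
  induction L with
  | zero => exact h0 ι
  | succ n ih => exact ih.then (h0 Unit)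

lemma SNet.nonneg {w L s : ℕ} {ι : Type} [Fintype ι] {f : (ι → ℝ) → ℝ} (h : SNet w L s ι f)
    (hL : 1 ≤ L) (x : ι → ℝ) : 0 ≤ f x := by
  have key : ∀ (L s : ℕ) (ι κ : Type) [Fintype ι] [Fintype κ] (F : (ι → ℝ) → κ → ℝ),
      Net w L s ι κ F → (1 ≤ L ∨ (L = 0 ∧ 0 ≤ 0)) → ∀ x k, 1 ≤ L ∨ (∀ i, 0 ≤ x i) →
      0 ≤ F x k := by
    intro L
    induction L with
    | zero =>
      intro s ι κ _ _ F h _ x k hx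
      obtain ⟨e, he⟩ := h
      rw [he]
      rcases hx with hx | hx
      · omega
      · exact hx _
    | succ L ih =>
      intro s ι κ _ _ F h _ x k _
      obtain ⟨μ, _, s₁, s₂, G, H, h1, h2, h3, h4, h5⟩ := h
      rw [h4]
      refine ih _ _ _ _ h3 (by omega) _ _ (Or.inr ?_)
      obtain ⟨W, v, -, -, -, hG⟩ := h1
      intro i
      rw [hG]
      exact le_max_right _ _
  exact key L s ι Unit _ h (Or.inl hL) x () (Or.inl hL)
/-! ### Conversion to fully connected networks -/

/-- Prepend a dimension. -/
def consDim (n : ℕ) (m : ℕ → ℕ) : ℕ → ℕ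
  | 0 => n
  | (k + 1) => m k

/-- Prepend a weight matrix. -/
def consMat (n : ℕ) (m : ℕ → ℕ) (W₀ : Matrix (Fin (m 0)) (Fin n) ℝ)
    (W : ∀ k : ℕ, Matrix (Fin (m (k + 1))) (Fin (m k)) ℝ) :
    ∀ k : ℕ, Matrix (Fin (consDim n m (k + 1))) (Fin (consDim n m k)) ℝ
  | 0 => W₀
  | (k + 1) => W k

/-- Prepend a bias vector. -/
def consBias (n : ℕ) (m : ℕ → ℕ) (v₀ : Fin (m 0) → ℝ) (v : ∀ k : ℕ, Fin (m k) → ℝ) :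
    ∀ k : ℕ, Fin (consDim n m k) → ℝ
  | 0 => fun _ => 0
  | 1 => v₀
  | (k + 2) => v (k + 1)

lemma fnnHidden_cons (n : ℕ) (m : ℕ → ℕ) (W₀ : Matrix (Fin (m 0)) (Fin n) ℝ)
    (W : ∀ k : ℕ, Matrix (Fin (m (k + 1))) (Fin (m k)) ℝ)
    (v₀ : Fin (m 0) → ℝ) (v : ∀ k : ℕ, Fin (m k) → ℝ) (x : Fin n → ℝ) (k : ℕ) :
    fnnHidden (consDim n m) (consMat n m W₀ W) (consBias n m v₀ v) (k + 1) x
      = fnnHidden m W v k (fun j => max (W₀.mulVec x j - v₀ j) 0) := by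
  induction k with
  | zero => rfl
  | succ k ih =>
    have h1 : fnnHidden (consDim n m) (consMat n m W₀ W) (consBias n m v₀ v) (k + 1 + 1) x
      = fun j => max ((W k).mulVec (fnnHidden (consDim n m) (consMat n m W₀ W)
          (consBias n m v₀ v) (k + 1) x) j - v (k + 1) j) 0 := rfl
    rw [h1, ih]
    rfl

lemma Net.toSeq {w : ℕ} : ∀ (L s : ℕ) (ι κ : Type) [Fintype ι] [Fintype κ]
    (F : (ι → ℝ) → κ → ℝ), Net w L s ι κ F → ∀ (c : κ → ℝ), (∀ k, |c k| ≤ 1) →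
    ∀ (n : ℕ) (e : Fin n ≃ ι), ∃ (m : ℕ → ℕ)
      (W : ∀ k : ℕ, Matrix (Fin (m (k + 1))) (Fin (m k)) ℝ)
      (v : ∀ k : ℕ, Fin (m k) → ℝ) (h0 : m 0 = n) (hL : m (L + 1) = 1),
      (∀ k, 1 ≤ k → k ≤ L → m k ≤ w) ∧
      (∑ k ∈ Finset.range (L + 1), ∑ j, ∑ i, nz (W k j i)) +
        (∑ k ∈ Finset.range L, ∑ j, nz (v (k + 1) j)) ≤ s + Fintype.card κ ∧
      (∀ k, k ≤ L → ∀ i j, |W k i j| ≤ 1) ∧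
      (∀ k, 1 ≤ k → k ≤ L → ∀ j, |v k j| ≤ 1) ∧
      ∀ x : ι → ℝ, ∑ k, c k * F x k
        = (W L).mulVec (fnnHidden m W v L fun i => x (e (Fin.cast h0 i)))
            (Fin.cast hL.symm 0) := by
  intro L
  induction L with
  | zero =>
    intro s ι κ _ _ F h c hc n e
    obtain ⟨e', he⟩ := h
    refine ⟨consDim n (fun _ => 1), consMat n (fun _ => 1) (fun _ i => c (e'.symm (e i)))
      (fun _ _ _ => 0), fun _ _ => 0, rfl, rfl, ?_, ?_, ?_, ?_, ?_⟩
    · intro k h1 h2; omega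
    · simp only [zero_add, Finset.range_one, Finset.sum_singleton, Finset.range_zero,
        Finset.sum_empty, add_zero]
      have : ∑ j : Fin (consDim n (fun _ => 1) 1), ∑ i : Fin (consDim n (fun _ => 1) 0),
          nz (consMat n (fun _ => 1) (fun _ i => c (e'.symm (e i))) (fun _ _ _ => 0) 0 j i)
          = ∑ _j : Fin 1, ∑ i : Fin n, nz (c (e'.symm (e i))) := rfl
      rw [this, Fintype.sum_unique]
      calc ∑ i : Fin n, nz (c (e'.symm (e i))) ≤ ∑ _i : Fin n, 1 :=
            Finset.sum_le_sum fun i _ => nz_le_one _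
        _ = n := by simp
        _ = Fintype.card κ := by
            rw [← Fintype.card_fin n]
            exact Fintype.card_congr (e.trans e'.symm)
        _ ≤ _ := by omega
    · intro k hk i j
      obtain rfl : k = 0 := by omega
      exact hc _
    · intro k h1 h2; omega
    · intro x
      have : ∀ y : Fin n → ℝ, Matrix.mulVec (m := Fin 1) (n := Fin n)
        (fun _ i => c (e'.symm (e i))) y 0 = ∑ i, c (e'.symm (e i)) * y i := by
        intro y; rfl
      refine Eq.trans ?_ (this (fun i => x (e i))).symm
      rw [← Equiv.sum_comp (e.trans e'.symm)]
      simp [he]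
  | succ L ih =>
    intro s ι κ _ _ F h c hc n e
    obtain ⟨μ, _, s₁, s₂, G, H, h1, h2, h3, h4, h5⟩ := h
    obtain ⟨m, W, v, h0, hL, a1, a2, a3, a4, a5⟩ :=
      ih s₂ μ κ H h3 c hc (Fintype.card μ) (Fintype.equivFin μ).symm
    obtain ⟨W₀, v₀, b1, b2, b3, b4⟩ := h1
    let e'' : Fin (m 0) ≃ μ := (finCongr h0).trans (Fintype.equivFin μ).symm
    refine ⟨consDim n m, consMat n m (fun j i => W₀ (e'' j) (e i)) W,
      consBias n m (fun j => v₀ (e'' j)) v, rfl, hL, ?_, ?_, ?_, ?_, ?_⟩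
    · intro k hk1 hk2
      obtain ⟨k, rfl⟩ : ∃ k', k = k' + 1 := ⟨k - 1, by omega⟩
      change m k ≤ w
      rcases Nat.eq_zero_or_pos k with rfl | hk
      · rw [h0]; exact h2
      · exact a1 k hk (by omega)
    · have i1 : ∑ j, ∑ i, nz (consMat n m (fun j i => W₀ (e'' j) (e i)) W 0 j i)
          = ∑ j, ∑ i, nz (W₀ j i) := by
        change ∑ j : Fin (m 0), ∑ i : Fin n, nz (W₀ (e'' j) (e i)) = _
        rw [← Equiv.sum_comp e'']
        refine Finset.sum_congr rfl fun j _ => ?_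
        rw [← Equiv.sum_comp e]
      have i2 : ∑ j, nz (consBias n m (fun j => v₀ (e'' j)) v (0 + 1) j)
          = ∑ j, nz (v₀ j) := by
        change ∑ j : Fin (m 0), nz (v₀ (e'' j)) = _
        rw [← Equiv.sum_comp e'']
      have i3 : ∑ k ∈ Finset.range (L + 1), ∑ j, ∑ i,
          nz (consMat n m (fun j i => W₀ (e'' j) (e i)) W (k + 1) j i)
          = ∑ k ∈ Finset.range (L + 1), ∑ j, ∑ i, nz (W k j i) := rfl
      have i4 : ∑ k ∈ Finset.range L, ∑ j,
          nz (consBias n m (fun j => v₀ (e'' j)) v (k + 1 + 1) j)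
          = ∑ k ∈ Finset.range L, ∑ j, nz (v (k + 1) j) := rfl
      have j1 := Finset.sum_range_succ' (fun k => ∑ j, ∑ i,
          nz (consMat n m (fun j i => W₀ (e'' j) (e i)) W k j i)) (L + 1)
      have j2 := Finset.sum_range_succ' (fun k => ∑ j,
          nz (consBias n m (fun j => v₀ (e'' j)) v (k + 1) j)) L
      beta_reduce at j1 j2
      rw [i1, i3] at j1
      rw [i2, i4] at j2
      refine (Nat.add_le_add j1.le j2.le).trans ?_
      omega
    · intro k hk i j
      cases k with
      | zero => exact b1 _ _
      | succ k => exact a3 k (by omega) i j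
    · intro k hk1 hk2 j
      match k, hk1, hk2, j with
      | 1, _, _, j => exact b2 _
      | (k + 2), _, hk, j => exact a4 (k + 1) (by omega) (by omega) j
    · intro x
      rw [h4, a5]
      refine Eq.trans ?_ (congrArg (fun y => (W L).mulVec y (Fin.cast hL.symm 0))
        (fnnHidden_cons n m (fun j i => W₀ (e'' j) (e i)) W (fun j => v₀ (e'' j)) v
          (fun i => x (e i)) L).symm)
      congr 2
      funext j
      rw [b4]
      congr 2
      change _ = ∑ i : Fin n, W₀ (e'' j) (e i) * x (e i)
      rw [← Equiv.sum_comp e]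
      rfl

lemma ncard_eq_sum_nz {α β : Type} [Fintype α] [Fintype β] (W : α → β → ℝ) :
    Set.ncard {p : α × β | W p.1 p.2 ≠ 0} = ∑ j, ∑ i, nz (W j i) := by
  classical
  rw [← Fintype.sum_prod_type' (f := fun j i => nz (W j i))]
  rw [Set.ncard_eq_toFinset_card', Set.toFinset_ofPred, Finset.card_filter]
  refine Finset.sum_congr rfl fun p _ => ?_
  unfold nz
  split_ifs <;> simp_all

lemma ncard_eq_sum_nz' {α : Type} [Fintype α] (v : α → ℝ) :
    Set.ncard {p : α | v p ≠ 0} = ∑ j, nz (v j) := by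
  classical
  rw [Set.ncard_eq_toFinset_card', Set.toFinset_ofPred, Finset.card_filter]
  refine Finset.sum_congr rfl fun p _ => ?_
  unfold nz
  split_ifs <;> simp_all

/-- A network with a linear readout is a fully connected network. -/
lemma Net.isFNN {w L s d : ℕ} {κ : Type} [Fintype κ] {F : (Fin d → ℝ) → κ → ℝ}
    (h : Net w L s (Fin d) κ F) (hL : 1 ≤ L) (c : κ → ℝ) (hc : ∀ k, |c k| ≤ 1)
    {G N S : ℝ} (hG : (L : ℝ) ≤ G) (hN : (w : ℝ) ≤ N)
    (hS : ((s + Fintype.card κ : ℕ) : ℝ) ≤ S) :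
    IsFNN d G N S 1 ⊤ (fun x => ∑ k, c k * F x k) := by
  obtain ⟨m, W, v, h0, hL1, a1, a2, a3, a4, a5⟩ :=
    Net.toSeq L s (Fin d) κ F h c hc d (Equiv.refl _)
  refine ⟨L, m, W, v, h0, hL1, hL, hG, ?_, ?_, a3, a4, fun x _ => le_top, ?_⟩
  · intro k h1 h2
    exact le_trans (by exact_mod_cast a1 k h1 h2) hN
  · refine le_trans ?_ hS
    have e1 : ∑ k ∈ Finset.Icc 1 L, Set.ncard {j : Fin (m k) | v k j ≠ 0}
        = ∑ k ∈ Finset.range L, ∑ j, nz (v (k + 1) j) := by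
      rw [Finset.range_eq_Ico, Finset.sum_Ico_add' (fun k => ∑ j, nz (v k j))]
      refine Finset.sum_congr ?_ fun k _ => ncard_eq_sum_nz' _
      ext k; simp
    have e2 : ∑ k ∈ Finset.range (L + 1),
          Set.ncard {p : Fin (m (k + 1)) × Fin (m k) | W k p.1 p.2 ≠ 0}
        = ∑ k ∈ Finset.range (L + 1), ∑ j, ∑ i, nz (W k j i) :=
      Finset.sum_congr rfl fun k _ => ncard_eq_sum_nz _
    rw [← e1, ← e2] at a2
    exact_mod_cast a2
  · intro x
    exact a5 x

/-! ### Networks of constant width and the basic gadgets -/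

lemma Lay.auto {s : ℕ} {ι κ : Type} [Fintype ι] [Fintype κ] {F : (ι → ℝ) → κ → ℝ}
    (h : Lay s ι κ F) : Lay (Fintype.card κ * (Fintype.card ι + 1)) ι κ F := by
  obtain ⟨W, v, hW, hv, hs, hF⟩ := h
  refine ⟨W, v, hW, hv, ?_, hF⟩
  rw [← Finset.sum_add_distrib]
  calc ∑ j, (∑ i, nz (W j i) + nz (v j)) ≤ ∑ _j : κ, (∑ _i : ι, 1 + 1) := by
        gcongr <;> exact nz_le_one _
    _ = _ := by simp

lemma Net.auto {w : ℕ} : ∀ {L s : ℕ} {ι κ : Type} [Fintype ι] [Fintype κ]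
    {F : (ι → ℝ) → κ → ℝ}, Net w L s ι κ F → Fintype.card ι ≤ w →
    Net w L (L * (w * (w + 1))) ι κ F := by
  intro L
  induction L with
  | zero => intro s ι κ _ _ F h _; exact h
  | succ L ih =>
    intro s ι κ _ _ F h hι
    obtain ⟨μ, _, s₁, s₂, G, H, h1, h2, h3, h4, h5⟩ := h
    refine ⟨μ, _, _, _, G, H, h1.auto, h2, ih h3 h2, h4, ?_⟩
    rw [Nat.succ_mul, add_comm]
    gcongr

/-- Scalar networks where only depth and width matter. -/
def CNet (w L : ℕ) (ι : Type) [Fintype ι] (f : (ι → ℝ) → ℝ) : Prop := ∃ s, SNet w L s ι f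

lemma CNet.sNet {w L : ℕ} {ι : Type} [Fintype ι] {f : (ι → ℝ) → ℝ} (h : CNet w L ι f)
    (hι : Fintype.card ι ≤ w) : SNet w L (L * (w * (w + 1))) ι f := by
  obtain ⟨s, hs⟩ := h
  exact Net.auto hs hι

lemma CNet.mono {w w' L : ℕ} {ι : Type} [Fintype ι] {f : (ι → ℝ) → ℝ} (h : CNet w L ι f)
    (hw : w ≤ w') : CNet w' L ι f := by
  obtain ⟨s, hs⟩ := h
  exact ⟨s, hs.mono hw le_rfl⟩

lemma CNet.congr {w L : ℕ} {ι : Type} [Fintype ι] {f f' : (ι → ℝ) → ℝ} (h : CNet w L ι f)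
    (hf : ∀ x, f x = f' x) : CNet w L ι f' := by
  have : f = f' := funext hf
  rwa [← this]

lemma CNet.nonneg {w L : ℕ} {ι : Type} [Fintype ι] {f : (ι → ℝ) → ℝ} (h : CNet w L ι f)
    (hL : 1 ≤ L) (x : ι → ℝ) : 0 ≤ f x := by
  obtain ⟨s, hs⟩ := h
  exact hs.nonneg hL x

lemma CNet.pad {w L : ℕ} {ι : Type} [Fintype ι] {f : (ι → ℝ) → ℝ} (h : CNet w L ι f)
    (hw : 1 ≤ w) (hL : 1 ≤ L) (n : ℕ) : CNet w (L + n) ι f := by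
  obtain ⟨s, hs⟩ := h
  exact ⟨_, hs.pad hw (fun x => hs.nonneg hL x) n⟩

lemma CNet.then {w L₁ L₂ : ℕ} {ι : Type} [Fintype ι]
    {f : (ι → ℝ) → ℝ} {g : (Unit → ℝ) → ℝ} (h1 : CNet w L₁ ι f)
    (h2 : CNet w L₂ Unit g) :
    CNet w (L₁ + L₂) ι (fun x => g (fun _ => f x)) := by
  obtain ⟨s, hs⟩ := h1
  obtain ⟨s', hs'⟩ := h2
  exact ⟨_, hs.then hs'⟩

lemma CNet.neuron {ι : Type} [Fintype ι] (c : ι → ℝ) (b : ℝ) (hc : ∀ i, |c i| ≤ 1)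
    (hb : |b| ≤ 1) : CNet 1 1 ι (fun x => max (∑ i, c i * x i - b) 0) :=
  ⟨_, SNet.neuron c b hc hb le_rfl⟩

lemma CNet.gadget {A : Type} [Fintype A] {w : A → ℕ} {w' L L' : ℕ} (hL : 1 ≤ L)
    {ι : Type} [Fintype ι] {f : A → (ι → ℝ) → ℝ} (h : ∀ a, CNet (w a) L ι (f a))
    {g : (A → ℝ) → ℝ} (hg : CNet w' L' A g) (hw : w' ≤ ∑ a, w a) :
    CNet (∑ a, w a) (L + L') ι (fun x => g (fun a => f a x)) := by
  choose s hs using h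
  obtain ⟨t, ht⟩ := hg
  exact ⟨_, (SNet.par hL hs).scomp (ht.mono hw le_rfl)⟩

lemma CNet.dbl {w L : ℕ} {ι : Type} [Fintype ι] {f : (ι → ℝ) → ℝ} (h : CNet w L ι f)
    (hw : 2 ≤ w) (hL : 1 ≤ L) : CNet w (L + 2) ι (fun x => 2 * f x) := by
  obtain ⟨s, hs⟩ := h
  have h1 := Net.copy (ι := Unit) (κ := Bool) (fun _ => ()) (w := w) (by simpa using hw)
  have h2 := SNet.neuron0 (ι := Bool) (fun _ => 1) (by simp) (w := w) (by omega)
  have h3 : CNet w 2 Unit _ := ⟨_, h1.scomp h2⟩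
  refine CNet.congr (CNet.then ⟨s, hs⟩ h3) ?_
  intro x
  have := hs.nonneg hL x
  simp only [one_mul, Fintype.sum_bool]
  rw [max_eq_left this, max_eq_left (by linarith)]
  ring

lemma CNet.dblIter {w L : ℕ} {ι : Type} [Fintype ι] {f : (ι → ℝ) → ℝ} (h : CNet w L ι f)
    (hw : 2 ≤ w) (hL : 1 ≤ L) (n : ℕ) : CNet w (L + 2 * n) ι (fun x => 2 ^ n * f x) := by
  induction n with
  | zero => simpa using h
  | succ n ih =>
    refine CNet.congr (ih.dbl hw (by omega)) fun x => ?_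
    ring

/-- The hat function. -/
def hat (u : ℝ) : ℝ := max (1 - |u|) 0

lemma hat_nonneg (u : ℝ) : 0 ≤ hat u := le_max_right _ _

lemma hat_le_one (u : ℝ) : hat u ≤ 1 := max_le (by linarith [abs_nonneg u]) zero_le_one

lemma CNet.hat {ι : Type} [Fintype ι] (i : ι) (n j : ℕ) (hj : j ≤ 2 ^ n) :
    CNet 2 (2 * n + 2) ι (fun x => hat (2 ^ n * x i - j)) := by
  classical
  have hN : (0 : ℝ) < 2 ^ n := by positivity
  have hN1 : (1 : ℝ) ≤ 2 ^ n := one_le_pow₀ (by norm_num)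
  have hjN : (j : ℝ) / 2 ^ n ≤ 1 := by
    rw [div_le_one hN]; exact_mod_cast hj
  have hj0 : (0 : ℝ) ≤ (j : ℝ) / 2 ^ n := by positivity
  have hf : ∀ b : Bool, CNet 1 1 ι
      (fun x => max (∑ i', (if i' = i then (if b then 1 else -1) else 0) * x i'
        - (if b then (j : ℝ) / 2 ^ n else -((j : ℝ) / 2 ^ n))) 0) := by
    intro b
    refine CNet.neuron _ _ ?_ ?_
    · intro i'; split_ifs <;> simp
    · split_ifs
      · rw [abs_of_nonneg hj0]; exact hjN
      · rw [abs_neg, abs_of_nonneg hj0]; exact hjN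
  have hg := CNet.neuron (ι := Bool) (fun _ => -1) (-(1 / 2 ^ n)) (by simp)
    (by rw [abs_neg, abs_of_nonneg (by positivity), div_le_one hN]; exact hN1)
  have h1 := CNet.gadget (w := fun _ => 1) le_rfl hf hg (by simp)
  have h2 := (CNet.mono h1 (w' := 2) (by simp)).dblIter le_rfl (by norm_num) n
  rw [show 1 + 1 + 2 * n = 2 * n + 2 by ring] at h2
  refine h2.congr fun x => ?_
  simp only [Fintype.sum_bool, ite_mul, zero_mul, Finset.sum_ite_eq', Finset.mem_univ, if_true,
    Bool.false_eq_true, if_false]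
  have key : ∀ y c : ℝ, max (-1 * max (1 * y - c) 0 + -1 * max (-1 * y - -c) 0 - -(1 / 2 ^ n)) 0
      = max (1 / 2 ^ n - |y - c|) 0 := by
    intro y c
    congr 1
    rcases le_total c y with h | h
    · rw [max_eq_left (by linarith), max_eq_right (by linarith), abs_of_nonneg (by linarith)]
      ring
    · rw [max_eq_right (by linarith), max_eq_left (by linarith), abs_of_nonpos (by linarith)]
      ring
  rw [key, DNNLogistic.hat, mul_max_of_nonneg _ _ hN.le, mul_zero, mul_sub,
    mul_one_div_cancel hN.ne']
  congr 2
  rw [← abs_of_pos hN, ← abs_mul, abs_of_pos hN, mul_sub, mul_div_cancel₀ _ hN.ne']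

lemma CNet.coord {ι : Type} [Fintype ι] (i : ι) (L : ℕ) :
    CNet 1 (L + 1) ι (fun x => max (x i) 0) := by
  have h : CNet 1 1 ι (fun x => max (x i) 0) :=
    ⟨_, Net.copy (ι := ι) (κ := Unit) (fun _ => i) (w := 1) (by simp)⟩
  rw [add_comm]
  exact h.pad le_rfl le_rfl L

lemma CNet.one {ι : Type} [Fintype ι] (L : ℕ) : CNet 1 (L + 1) ι (fun _ => 1) := by
  have h := CNet.neuron (ι := ι) (fun _ => 0) (-1) (by simp) (by simp)
  rw [add_comm]
  refine CNet.congr (h.pad le_rfl le_rfl L) fun x => ?_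
  simp

/-- The recursive approximation of `y (1 - y)`. -/
lemma sq_state (k : ℕ) : ∃ (s : ℕ) (F : (Unit → ℝ) → Fin 3 → ℝ), Net 3 (k + 1) s Unit (Fin 3) F ∧
    ∀ y : Unit → ℝ, 0 ≤ y () → y () ≤ 1 → 0 ≤ F y 0 - F y 1 ∧
      F y 0 - F y 1 ≤ (1 / 4) ^ (k + 1) ∧ 0 ≤ F y 2 ∧
      (1 / 4) ^ (k + 1) * (y () * (1 - y ()))
        = (1 / 4) ^ (k + 1) * (F y 2 + 2 * (F y 0 - F y 1)) - (F y 0 - F y 1) ^ 2 := by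
  induction k with
  | zero =>
    refine ⟨_, _, Net.layer (ι := Unit) (κ := Fin 3) (fun j _ => ![1 / 2, 1, 0] j)
      (![0, 1 / 2, 0]) ?_ ?_ (by simp), ?_⟩
    · intro j _; fin_cases j <;> simp [abs_of_pos]; norm_num
    · intro j; fin_cases j <;> simp [abs_of_pos]; norm_num
    · intro y h0 h1
      simp only [Finset.univ_unique, Finset.sum_singleton, Matrix.cons_val_zero,
        Matrix.cons_val_one, Matrix.cons_val, PUnit.default_eq_unit]
      generalize y () = z at *
      rcases le_total z (1 / 2) with h | h
      · rw [max_eq_left (by linarith), max_eq_right (by linarith), max_eq_right (by linarith)]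
        refine ⟨by linarith, by norm_num; linarith, le_rfl, by ring⟩
      · rw [max_eq_left (by linarith), max_eq_left (by linarith), max_eq_right (by linarith)]
        refine ⟨by linarith, by norm_num; linarith, le_rfl, by ring⟩
  | succ k ih =>
    obtain ⟨s, F, hF, hP⟩ := ih
    have hc0 : (0 : ℝ) < (1 / 4) ^ (k + 1) := by positivity
    have hc1 : ((1 : ℝ) / 4) ^ (k + 1) ≤ 1 := pow_le_one₀ (by norm_num) (by norm_num)
    have hl := Net.layer (ι := Fin 3) (κ := Fin 3)
      (fun j => ![![1 / 2, -(1 / 2), 0], ![1, -1, 0], ![1, -1, 1]] j)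
      (![0, (1 / 4) ^ (k + 1) / 2, 0]) (w := 3) (by
        intro j i
        fin_cases j <;> fin_cases i <;> simp [abs_of_pos] <;> norm_num) (by
        intro j
        fin_cases j
        · simp
        · change |((1 : ℝ) / 4) ^ (k + 1) / 2| ≤ 1
          rw [abs_of_pos (by linarith)]; linarith
        · simp) (by simp)
    refine ⟨_, _, hF.comp hl, ?_⟩
    intro y h0 h1
    obtain ⟨p1, p2, p3, p4⟩ := hP y h0 h1
    simp only [Fin.sum_univ_three, Matrix.cons_val_zero,
        Matrix.cons_val_one, Matrix.cons_val]
    rw [pow_succ (1 / 4 : ℝ) (k + 1)]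
    generalize ((1 : ℝ) / 4) ^ (k + 1) = c at *
    generalize y () * (1 - y ()) = Y at *
    generalize F y 0 = a at *
    generalize F y 1 = b at *
    generalize F y 2 = d at *
    rw [max_eq_left (by linarith : (0:ℝ) ≤ 1 / 2 * a + -(1 / 2) * b + 0 * d - 0),
      max_eq_left (by linarith : (0:ℝ) ≤ 1 * a + -1 * b + 1 * d - 0)]
    rcases le_total (a - b) (c / 2) with h | h
    · rw [max_eq_right (by linarith)]
      refine ⟨by linarith, by linarith, by linarith, by linarith⟩
    · rw [max_eq_left (by linarith)]
      refine ⟨by linarith, by linarith, by linarith, by linarith⟩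

lemma sq_net (t : ℕ) : ∃ f : (Unit → ℝ) → ℝ, CNet 3 (t + 2) Unit f ∧
    ∀ y : Unit → ℝ, 0 ≤ y () → y () ≤ 1 → 0 ≤ y () * (1 - y ()) - f y ∧
      y () * (1 - y ()) - f y ≤ (1 / 4) ^ t := by
  obtain ⟨s, F, hF, hP⟩ := sq_state t
  have h2 : SNet 3 1 _ (Fin 3) (fun x => max (x 2) 0) :=
    Net.copy (ι := Fin 3) (κ := Unit) (fun _ => 2) (by simp)
  refine ⟨_, ⟨_, hF.scomp h2⟩, ?_⟩
  intro y h0 h1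
  obtain ⟨p1, p2, p3, p4⟩ := hP y h0 h1
  have hc0 : (0 : ℝ) < (1 / 4) ^ (t + 1) := by positivity
  have hc1 : ((1 : ℝ) / 4) ^ t = 4 * (1 / 4) ^ (t + 1) := by rw [pow_succ]; ring
  rw [max_eq_left p3, hc1]
  generalize ((1 : ℝ) / 4) ^ (t + 1) = c at *
  generalize y () * (1 - y ()) = Y at *
  generalize F y 2 = d at *
  generalize F y 0 - F y 1 = z at *
  have e : c * (Y - d) = z * (2 * c - z) := by linarith
  constructor
  · have : 0 ≤ c * (Y - d) := by rw [e]; exact mul_nonneg p1 (by linarith)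
    exact nonneg_of_mul_nonneg_right this hc0
  · have : c * (Y - d) ≤ c * (4 * c) := by
      rw [e]; nlinarith
    exact le_of_mul_le_mul_left this hc0

/-- Approximate multiplication of two numbers in `[0,1]`. -/
lemma mult_net (t : ℕ) : ∃ f : (Bool → ℝ) → ℝ, CNet 7 (t + 6) Bool f ∧
    (∀ x, 0 ≤ f x) ∧ (∀ x, f x ≤ 1) ∧
    ∀ x : Bool → ℝ, (∀ b, 0 ≤ x b) → (∀ b, x b ≤ 1) →
      |f x - x true * x false| ≤ (1 / 4) ^ t := by
  obtain ⟨g, hg, hgP⟩ := sq_net t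
  have hu := CNet.neuron (ι := Bool) (fun b => if b then 1 / 2 else -(1 / 2)) (-(1 / 2))
    (by intro b; cases b <;> simp [abs_of_pos] <;> norm_num) (by rw [abs_neg, abs_of_pos] <;> norm_num)
  have hv := CNet.neuron (ι := Bool) (fun b => 1 / 2) 0
    (by intro b; rw [abs_of_pos] <;> norm_num) (by simp)
  have h0 := (hu.mono (w' := 3) (by norm_num)).then hg
  have h1 := (hv.mono (w' := 3) (by norm_num)).then hg
  have h2 := hv.pad le_rfl le_rfl (t + 2)
  let u : (Bool → ℝ) → ℝ :=
    fun x => max (∑ i, (if i then 1 / 2 else -(1 / 2)) * x i - -(1 / 2)) 0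
  let v : (Bool → ℝ) → ℝ := fun x => max (∑ i, 1 / 2 * x i - 0) 0
  have hA : ∀ a : Fin 3, CNet (![3, 3, 1] a) (1 + (t + 2)) Bool
      (![fun x => g (fun _ => u x), fun x => g (fun _ => v x), v] a) := by
    intro a
    fin_cases a
    · exact h0
    · exact h1
    · exact h2
  have hn := CNet.neuron (ι := Fin 3) (![1, -1, 1]) (1 / 4)
    (by intro i; fin_cases i <;> simp) (by rw [abs_of_pos] <;> norm_num)
  have hB := CNet.gadget (by omega) hA hn (by simp [Fin.sum_univ_three])
  have hm := CNet.neuron (ι := Unit) (fun _ => -1) (-1) (by simp) (by simp)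
  have hm7 := hm.mono (w' := ∑ a, ![3, 3, 1] a) (by simp [Fin.sum_univ_three])
  have hC := (hB.then hm7).then hm7
  have hw : ∑ a, ![3, 3, 1] a = 7 := by simp [Fin.sum_univ_three]
  rw [hw, show 1 + (t + 2) + 1 + 1 + 1 = t + 6 by ring] at hC
  refine ⟨_, hC, fun x => hC.nonneg (by omega) x, ?_, ?_⟩
  · intro x
    simp only [Finset.univ_unique, Finset.sum_singleton]
    refine max_le ?_ zero_le_one
    have := le_max_right (-1 * max (∑ i, ![1, -1, 1] i *
      ![fun x => g (fun _ => u x), fun x => g (fun _ => v x), v] i x - 1 / 4) 0 - -1) 0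
    linarith
  · intro x hx0 hx1
    have a0 := hx0 true
    have a1 := hx0 false
    have b0 := hx1 true
    have b1 := hx1 false
    have eu : u x = (x true - x false + 1) / 2 := by
      simp only [u, Fintype.sum_bool, if_true, Bool.false_eq_true, if_false]
      rw [max_eq_left (by linarith)]; ring
    have ev : v x = (x true + x false) / 2 := by
      simp only [v, Fintype.sum_bool]
      rw [max_eq_left (by linarith)]; ring
    obtain ⟨q1, q2⟩ := hgP (fun _ => u x) (by rw [eu]; linarith)
      (by rw [eu]; linarith)
    obtain ⟨q3, q4⟩ := hgP (fun _ => v x) (by rw [ev]; linarith)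
      (by rw [ev]; linarith)
    simp only [Finset.univ_unique, Finset.sum_singleton, Fin.sum_univ_three,
      Matrix.cons_val_zero, Matrix.cons_val_one, Matrix.cons_val]
    rw [ev] at q3 q4 ⊢
    rw [eu] at q1 q2 ⊢
    have hp0 : 0 ≤ x true * x false := mul_nonneg a0 a1
    have hp1 : x true * x false ≤ 1 := mul_le_one₀ b0 a1 b1
    generalize g (fun _ => (x true - x false + 1) / 2) = A at *
    generalize g (fun _ => (x true + x false) / 2) = B at *
    generalize ((1 : ℝ) / 4) ^ t = E at *
    have hy : |(1 * A + -1 * B + 1 * ((x true + x false) / 2) - 1 / 4) - x true * x false|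
        ≤ E := by
      rw [abs_le]
      constructor <;> nlinarith
    generalize (1 * A + -1 * B + 1 * ((x true + x false) / 2) - 1 / 4) = y at *
    generalize x true * x false = p at *
    rw [abs_le] at hy ⊢
    obtain ⟨y1, y2⟩ := hy
    rcases max_cases y 0 with ⟨e1, _⟩ | ⟨e1, _⟩ <;> rw [e1] <;>
    rcases max_cases (-1 * y - -1) 0 with ⟨e2, _⟩ | ⟨e2, _⟩ <;> (try rw [e2]) <;>
    (constructor <;> first
      | (apply le_sub_iff_add_le.2; apply le_max_of_le_left; linarith)
      | (apply sub_le_iff_le_add.2; apply max_le <;> linarith)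
      | (norm_num; linarith))

/-! ### Products and the partition of unity -/

lemma prod_net {ι : Type} [Fintype ι] (t w L : ℕ) (hL : 1 ≤ L) (hw : 1 ≤ w) (n : ℕ) :
    ∀ f : Fin n → (ι → ℝ) → ℝ, (∀ j, CNet w L ι (f j)) →
    ∃ P : (ι → ℝ) → ℝ, CNet (n * w + 7) (L + n * (t + 6)) ι P ∧ (∀ x, 0 ≤ P x) ∧
      (∀ x, P x ≤ 1) ∧ ∀ x, (∀ j, 0 ≤ f j x) → (∀ j, f j x ≤ 1) →
        |P x - ∏ j, f j x| ≤ n * (1 / 4) ^ t := by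
  induction n with
  | zero =>
    intro f _
    obtain ⟨L', rfl⟩ : ∃ L', L = L' + 1 := ⟨L - 1, by omega⟩
    refine ⟨fun _ => 1, ?_, by simp, by simp, by simp⟩
    have := CNet.one (ι := ι) L'
    simp only [zero_mul, add_zero, zero_add]
    exact this.mono (by omega)
  | succ n ih =>
    intro f hf
    obtain ⟨P, hP, hP0, hP1, hPe⟩ := ih (fun j => f j.castSucc) (fun j => hf _)
    obtain ⟨g, hg, hg0, hg1, hge⟩ := mult_net t
    have hlast := (hf (Fin.last n)).pad hw hL (n * (t + 6))
    have hcomb := CNet.gadget (A := Bool) (w := fun b => if b then n * w + 7 else w)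
      (L := L + n * (t + 6)) (by omega)
      (f := fun b => if b then P else f (Fin.last n))
      (by intro b; cases b <;> simpa using by assumption) hg (by simp; omega)
    refine ⟨_, by
      have e : L + (n + 1) * (t + 6) = L + n * (t + 6) + (t + 6) := by ring
      rw [e]
      exact hcomb.mono (by simp; nlinarith), fun x => hg0 _,
      fun x => hg1 _, ?_⟩
    intro x h0 h1
    have e1 := hge (fun b => (if b then P else f (Fin.last n)) x)
      (by intro b; cases b <;> simp [hP0, h0]) (by intro b; cases b <;> simp [hP1, h1])
    have e2 := hPe x (fun j => h0 _) (fun j => h1 _)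
    rw [Fin.prod_univ_castSucc]
    simp only [if_true, Bool.false_eq_true, if_false] at e1
    have e3 : |P x * f (Fin.last n) x - (∏ j : Fin n, f j.castSucc x) * f (Fin.last n) x|
        ≤ n * (1 / 4) ^ t := by
      rw [← sub_mul, abs_mul, abs_of_nonneg (h0 (Fin.last n))]
      calc _ ≤ |P x - ∏ j : Fin n, f j.castSucc x| * 1 :=
            mul_le_mul_of_nonneg_left (h1 _) (abs_nonneg _)
        _ ≤ _ := by rw [mul_one]; exact e2
    have := abs_sub_le (g fun b => (if b then P else f (Fin.last n)) x)
      (P x * f (Fin.last n) x) ((∏ j : Fin n, f j.castSucc x) * f (Fin.last n) x)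
    push_cast
    linarith

lemma hat_sum (N : ℕ) (y : ℝ) (hy : 0 ≤ y) :
    ∑ j ∈ Finset.range (N + 1), hat (y - j) = min 1 (max 0 (N + 1 - y)) := by
  induction N with
  | zero =>
    simp [hat, abs_of_nonneg hy]
    rw [max_comm, min_eq_right]
    exact max_le (by norm_num) (by linarith)
  | succ N ih =>
    rw [Finset.sum_range_succ, ih]
    unfold hat
    push_cast
    rcases le_total y N with h | h
    · rw [abs_of_nonpos (by linarith), max_eq_right (by linarith : (0 : ℝ) ≤ N + 1 - y),
        min_eq_left (by linarith), max_eq_right (by linarith), max_eq_right (by linarith),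
        min_eq_left (by linarith)]
      ring
    · rcases le_total y (N + 1) with h' | h'
      · rw [abs_of_nonpos (by linarith), max_eq_right (by linarith : (0 : ℝ) ≤ N + 1 - y),
          min_eq_right (by linarith), max_eq_left (by linarith), max_eq_right (by linarith),
          min_eq_left (by linarith)]
        ring
      · rw [abs_of_nonneg (by linarith), max_eq_left (by linarith : (N : ℝ) + 1 - y ≤ 0),
          min_eq_right (by linarith)]
        rw [max_comm, zero_add, min_eq_right (max_le (by norm_num) (by linarith))]
        ring_nf

lemma hat_partition {m : ℕ} (n : ℕ) (x : Fin m → ℝ) (hx : x ∈ cube m) :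
    ∑ a : Fin m → Fin (2 ^ n + 1), ∏ i, hat (2 ^ n * x i - (a i : ℕ)) = 1 := by
  have h := Finset.prod_univ_sum (fun _ : Fin m => (Finset.univ : Finset (Fin (2 ^ n + 1))))
    (fun i j => hat (2 ^ n * x i - (j : ℕ)))
  rw [Fintype.piFinset_univ] at h
  rw [← h]
  refine Finset.prod_eq_one fun i _ => ?_
  have hx0 := (hx i).1
  have hx1 := (hx i).2
  rw [Fin.sum_univ_eq_sum_range (fun j => hat (2 ^ n * x i - (j : ℕ))) (2 ^ n + 1),
    hat_sum _ _ (by positivity)]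
  have : (2 : ℝ) ^ n * x i ≤ 2 ^ n := mul_le_of_le_one_right (by positivity) hx1
  push_cast
  rw [max_eq_right (by linarith), min_eq_left (by linarith)]

lemma hat_support {n a : ℕ} {y : ℝ} (h : hat (2 ^ n * y - a) ≠ 0) :
    |y - a / 2 ^ n| ≤ (1 / 2) ^ n := by
  have hN : (0 : ℝ) < 2 ^ n := by positivity
  have h1 : |2 ^ n * y - a| < 1 := by
    by_contra hc
    exact h (by unfold hat; exact max_eq_right (by linarith))
  have e : y - a / 2 ^ n = (2 ^ n * y - a) / 2 ^ n := by field_simp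
  rw [e, abs_div, abs_of_pos hN, one_div, inv_pow, div_eq_mul_inv]
  exact mul_le_of_le_one_left (by positivity) h1.le

/-! ### Taylor expansion on the cube -/

/-- Hölder condition with `k` derivatives bounded by `r` and exponent `lam`. -/
def HC (m k : ℕ) (r lam : ℝ) (g : (Fin m → ℝ) → ℝ) : Prop :=
  (∀ l : List (Fin m), l.length < k → DifferentiableOn ℝ (derivListW m l g) (cube m)) ∧
  (∀ l : List (Fin m), l.length ≤ k → ∀ x ∈ cube m, |derivListW m l g x| ≤ r) ∧
  (∀ l : List (Fin m), l.length = k → ∀ x ∈ cube m, ∀ z ∈ cube m,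
      |derivListW m l g x - derivListW m l g z| ≤ r * eucDist x z ^ lam)

lemma HC.diff {m k : ℕ} {r lam : ℝ} {g : (Fin m → ℝ) → ℝ} (h : HC m (k + 1) r lam g) :
    DifferentiableOn ℝ g (cube m) := h.1 [] (by simp)

lemma HC.bdd {m k : ℕ} {r lam : ℝ} {g : (Fin m → ℝ) → ℝ} (h : HC m k r lam g) :
    ∀ x ∈ cube m, |g x| ≤ r := h.2.1 [] (by simp)

lemma HC.pd {m k : ℕ} {r lam : ℝ} {g : (Fin m → ℝ) → ℝ} (h : HC m (k + 1) r lam g) (i : Fin m) :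
    HC m k r lam (pderivW m i g) :=
  ⟨fun l hl => h.1 (i :: l) (by simpa using hl), fun l hl => h.2.1 (i :: l) (by simpa using hl),
    fun l hl => h.2.2 (i :: l) (by simpa using hl)⟩

lemma MemHolderBall.hc {m : ℕ} (hm : 0 < m) {β r : ℝ} {g : (Fin m → ℝ) → ℝ}
    (h : MemHolderBall m β r g) : HC m (⌈β⌉₊ - 1) r (β - (⌈β⌉₊ : ℝ) + 1) g := by
  obtain ⟨h1, -, A, B, hAB, hA, hB⟩ := h
  have z0 : (fun _ => 0 : Fin m → ℝ) ∈ cube m := fun i => by simp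
  have z1 : (fun _ => 1 : Fin m → ℝ) ∈ cube m := fun i => by simp
  have hA0 : 0 ≤ A := le_trans (abs_nonneg _) (hA [] (by simp) _ z0)
  have hd : 0 < eucDist (fun _ => 0 : Fin m → ℝ) (fun _ => 1) := by
    unfold eucDist; simp [hm]
  have hB0 : 0 ≤ B := by
    have := hB (List.replicate (⌈β⌉₊ - 1) ⟨0, hm⟩) (by simp) _ z0 _ z1
      (fun he => by have := congrFun he ⟨0, hm⟩; simp at this)
    have h2 : 0 < eucDist (fun _ => 0 : Fin m → ℝ) (fun _ => 1) ^ (β - (⌈β⌉₊ : ℝ) + 1) :=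
      Real.rpow_pos_of_pos hd _
    exact nonneg_of_mul_nonneg_left (le_trans (abs_nonneg _) this) h2
  refine ⟨h1, fun l hl x hx => (hA l hl x hx).trans (by linarith), fun l hl x hx z hz => ?_⟩
  have hpos : 0 ≤ eucDist x z ^ (β - (⌈β⌉₊ : ℝ) + 1) := Real.rpow_nonneg (Real.sqrt_nonneg _) _
  by_cases hxz : x = z
  · subst hxz
    rw [sub_self, abs_zero]
    exact mul_nonneg (by linarith) hpos
  · exact (hB l hl x hx z hz hxz).trans (mul_le_mul_of_nonneg_right (by linarith) hpos)

lemma eucDist_le {m : ℕ} {x z : Fin m → ℝ} {s : ℝ} (hs : 0 ≤ s) (h : ∀ i, |x i - z i| ≤ s) :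
    eucDist x z ≤ m * s := by
  unfold eucDist
  apply Real.sqrt_le_iff.2
  refine ⟨by positivity, ?_⟩
  have h1 : ∑ i, (x i - z i) ^ 2 ≤ ∑ _i : Fin m, s ^ 2 := by
    refine Finset.sum_le_sum fun i _ => ?_
    rw [← sq_abs]
    exact pow_le_pow_left₀ (abs_nonneg _) (h i) 2
  refine h1.trans ?_
  simp only [Finset.sum_const, Finset.card_univ, Fintype.card_fin, nsmul_eq_mul]
  rw [mul_pow]
  refine mul_le_mul_of_nonneg_right ?_ (sq_nonneg s)
  exact_mod_cast Nat.le_self_pow (by norm_num) m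

lemma line_deriv {m : ℕ} {g : (Fin m → ℝ) → ℝ} (hg : DifferentiableOn ℝ g (cube m))
    {a h : Fin m → ℝ} (hmem : ∀ t ∈ Set.Icc (0 : ℝ) 1, (a + t • h) ∈ cube m)
    (t : ℝ) (ht : t ∈ Set.Icc (0 : ℝ) 1) :
    HasDerivWithinAt (fun t : ℝ => g (a + t • h)) (∑ i, h i * pderivW m i g (a + t • h))
      (Set.Icc 0 1) t := by
  have h1 := (hg _ (hmem t ht)).hasFDerivWithinAt
  have h2 : HasDerivWithinAt (fun t : ℝ => a + t • h) h (Set.Icc 0 1) t := by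
    have := ((hasDerivAt_id t).smul_const h).const_add a
    simpa using this.hasDerivWithinAt
  have h3 := h1.comp_hasDerivWithinAt t h2 hmem
  refine h3.congr_deriv ?_
  have := LinearMap.pi_apply_eq_sum_univ (fderivWithin ℝ g (cube m) (a + t • h)).toLinearMap h
  simp only [ContinuousLinearMap.coe_coe] at this
  rw [this]
  refine Finset.sum_congr rfl fun i _ => ?_
  rw [smul_eq_mul]
  congr 2
  funext j
  simp [Pi.single_apply, eq_comm]

lemma line_mem {m : ℕ} {a h : Fin m → ℝ} (ha : a ∈ cube m) (hh : a + h ∈ cube m)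
    (t : ℝ) (ht : t ∈ Set.Icc (0 : ℝ) 1) : (a + t • h) ∈ cube m := by
  intro i
  have h1 := ha i
  have h2 := hh i
  simp only [Pi.add_apply, Pi.smul_apply, smul_eq_mul, Set.mem_Icc] at *
  constructor <;> nlinarith [ht.1, ht.2, h1.1, h1.2, h2.1, h2.2]

/-- Homogeneous Taylor terms (without factorial). -/
def DT (m : ℕ) : ℕ → ((Fin m → ℝ) → ℝ) → (Fin m → ℝ) → (Fin m → ℝ) → ℝ
  | 0, g, a, _ => g a
  | (j + 1), g, a, h => ∑ i, h i * DT m j (pderivW m i g) a h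

/-- Taylor polynomial. -/
def Tay (m k : ℕ) (g : (Fin m → ℝ) → ℝ) (a : Fin m → ℝ) (t : ℝ) (h : Fin m → ℝ) : ℝ :=
  ∑ j ∈ Finset.range (k + 1), t ^ j / (j.factorial : ℝ) * DT m j g a h

lemma Tay_deriv (m k : ℕ) (g : (Fin m → ℝ) → ℝ) (a h : Fin m → ℝ) (t : ℝ) :
    HasDerivAt (fun t => Tay m (k + 1) g a t h) (∑ i, h i * Tay m k (pderivW m i g) a t h) t := by
  have e : (fun t => Tay m (k + 1) g a t h) = fun t =>
      (∑ j ∈ Finset.range (k + 1), t ^ (j + 1) / ((j + 1).factorial : ℝ) * DT m (j + 1) g a h)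
        + g a := by
    funext t
    unfold Tay
    rw [Finset.sum_range_succ']
    simp [DT]
  rw [e]
  have h1 : HasDerivAt (fun t : ℝ => ∑ j ∈ Finset.range (k + 1),
      t ^ (j + 1) / ((j + 1).factorial : ℝ) * DT m (j + 1) g a h)
      (∑ j ∈ Finset.range (k + 1), t ^ j / (j.factorial : ℝ) * DT m (j + 1) g a h) t := by
    refine HasDerivAt.fun_sum fun j _ => ?_
    have := ((hasDerivAt_pow (j + 1) t).div_const ((j + 1).factorial : ℝ)).mul_const
      (DT m (j + 1) g a h)
    refine this.congr_deriv ?_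
    congr 1
    rw [Nat.factorial_succ]
    have : (j.factorial : ℝ) ≠ 0 := by positivity
    push_cast
    field_simp
  refine (h1.add_const (g a)).congr_deriv ?_
  unfold Tay
  simp only [DT, Finset.mul_sum]
  rw [Finset.sum_comm]
  refine Finset.sum_congr rfl fun i _ => Finset.sum_congr rfl fun j _ => by ring

lemma Tay_bound {m : ℕ} {r lam s : ℝ} (hr : 0 ≤ r) (hlam : 0 ≤ lam) (hs : 0 ≤ s)
    {a h : Fin m → ℝ} (ha : a ∈ cube m) (hh : a + h ∈ cube m) (hhs : ∀ i, |h i| ≤ s) (k : ℕ) :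
    ∀ g : (Fin m → ℝ) → ℝ, HC m k r lam g → ∀ t ∈ Set.Icc (0 : ℝ) 1,
      |g (a + t • h) - Tay m k g a t h| ≤ (m * s) ^ k * (r * (m * s) ^ lam) := by
  induction k with
  | zero =>
    intro g hg t ht
    have h1 := hg.2.2 [] rfl _ (line_mem ha hh t ht) a ha
    simp only [derivListW] at h1
    simp only [Tay, zero_add, Finset.range_one, Finset.sum_singleton, pow_zero, DT,
      Nat.factorial_zero, Nat.cast_one, div_one, one_mul]
    refine h1.trans (mul_le_mul_of_nonneg_left ?_ hr)
    refine Real.rpow_le_rpow (Real.sqrt_nonneg _) (eucDist_le hs fun i => ?_) hlam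
    simp only [Pi.add_apply, Pi.smul_apply, smul_eq_mul, add_sub_cancel_left, abs_mul]
    rw [abs_of_nonneg ht.1]
    exact (mul_le_of_le_one_left (abs_nonneg _) ht.2).trans (hhs i)
  | succ k ih =>
    intro g hg t ht
    have hd : ∀ t ∈ Set.Icc (0 : ℝ) 1, HasDerivWithinAt
        (fun t => g (a + t • h) - Tay m (k + 1) g a t h)
        (∑ i, h i * pderivW m i g (a + t • h) - ∑ i, h i * Tay m k (pderivW m i g) a t h)
        (Set.Icc 0 1) t := fun t ht =>
      (line_deriv hg.diff (line_mem ha hh) t ht).sub (Tay_deriv m k g a h t).hasDerivWithinAt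
    have := norm_image_sub_le_of_norm_deriv_le_segment' hd
      (C := (m * s) ^ (k + 1) * (r * (m * s) ^ lam)) ?_ t ht
    · have e0 : g (a + (0 : ℝ) • h) - Tay m (k + 1) g a 0 h = 0 := by
        unfold Tay
        rw [Finset.sum_range_succ']
        simp [DT]
      rw [e0, sub_zero, Real.norm_eq_abs] at this
      refine this.trans (mul_le_of_le_one_right ?_ (by linarith [ht.2]))
      have := Real.rpow_nonneg (show (0 : ℝ) ≤ m * s by positivity) lam
      positivity
    · intro u hu
      have hu' : u ∈ Set.Icc (0 : ℝ) 1 := ⟨hu.1, hu.2.le⟩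
      rw [← Finset.sum_sub_distrib, Real.norm_eq_abs]
      have hp : 0 ≤ (m * s) ^ k * (r * (m * s) ^ lam) := by
        have := Real.rpow_nonneg (show (0 : ℝ) ≤ m * s by positivity) lam
        positivity
      calc _ ≤ ∑ i, |h i * pderivW m i g (a + u • h) - h i * Tay m k (pderivW m i g) a u h| :=
            Finset.abs_sum_le_sum_abs _ _
        _ ≤ ∑ _i : Fin m, s * ((m * s) ^ k * (r * (m * s) ^ lam)) := by
            refine Finset.sum_le_sum fun i _ => ?_
            rw [← mul_sub, abs_mul]
            exact mul_le_mul (hhs i) (ih _ (hg.pd i) u hu') (abs_nonneg _) hs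
        _ = _ := by
            simp only [Finset.sum_const, Finset.card_univ, Fintype.card_fin, nsmul_eq_mul]
            ring

lemma HC.modulus {m k : ℕ} {r lam s θ : ℝ} (hr : 0 ≤ r) (hs : 0 ≤ s) (hlam : 0 ≤ lam)
    (hθ : (k = 0 ∧ θ = lam) ∨ (1 ≤ k ∧ θ = 1))
    {g : (Fin m → ℝ) → ℝ} (hg : HC m k r lam g) {x z : Fin m → ℝ} (hx : x ∈ cube m)
    (hz : z ∈ cube m) (h : ∀ i, |x i - z i| ≤ s) : |g x - g z| ≤ r * (m * s) ^ θ := by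
  rcases hθ with ⟨rfl, rfl⟩ | ⟨hk, rfl⟩
  · have h1 := hg.2.2 [] rfl x hx z hz
    simp only [derivListW] at h1
    exact h1.trans (mul_le_mul_of_nonneg_left
      (Real.rpow_le_rpow (Real.sqrt_nonneg _) (eucDist_le hs h) hlam) hr)
  · obtain ⟨k, rfl⟩ : ∃ k', k = k' + 1 := ⟨k - 1, by omega⟩
    have hmem : ∀ t ∈ Set.Icc (0 : ℝ) 1, (z + t • (x - z)) ∈ cube m :=
      line_mem hz (by simpa using hx)
    have := norm_image_sub_le_of_norm_deriv_le_segment' (line_deriv hg.diff hmem)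
      (C := r * (m * s)) ?_ 1 (by simp)
    · simpa using this
    · intro u hu
      have hu' : u ∈ Set.Icc (0 : ℝ) 1 := ⟨hu.1, hu.2.le⟩
      rw [Real.norm_eq_abs]
      calc _ ≤ ∑ i, |(x - z) i * pderivW m i g (z + u • (x - z))| :=
            Finset.abs_sum_le_sum_abs _ _
        _ ≤ ∑ _i : Fin m, s * r := by
            refine Finset.sum_le_sum fun i _ => ?_
            rw [abs_mul]
            exact mul_le_mul (h i) ((hg.pd i).bdd _ (hmem u hu')) (abs_nonneg _) hs
        _ = _ := by
            simp only [Finset.sum_const, Finset.card_univ, Fintype.card_fin, nsmul_eq_mul]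
            ring

/-- Value of a coordinate or of the constant one. -/
def xo {m : ℕ} (x : Fin m → ℝ) : Option (Fin m) → ℝ
  | none => 1
  | some i => x i

/-- Polynomials of degree at most `k` with coefficients bounded by `R`. -/
def IsPoly (m k : ℕ) (R : ℝ) (p : (Fin m → ℝ) → ℝ) : Prop :=
  ∃ c : (Fin k → Option (Fin m)) → ℝ, (∀ e, |c e| ≤ R) ∧ ∀ x, p x = ∑ e, c e * ∏ j, xo x (e j)

lemma IsPoly.const (m : ℕ) (R c : ℝ) (h : |c| ≤ R) : IsPoly m 0 R (fun _ => c) :=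
  ⟨fun _ => c, fun _ => h, fun x => by simp⟩

lemma IsPoly.mono {m k : ℕ} {R R' : ℝ} {p : (Fin m → ℝ) → ℝ} (h : IsPoly m k R p) (hR : R ≤ R') :
    IsPoly m k R' p := by
  obtain ⟨c, h1, h2⟩ := h
  exact ⟨c, fun e => (h1 e).trans hR, h2⟩

lemma IsPoly.affine {m k : ℕ} {R : ℝ} {p : (Fin m → ℝ) → ℝ} (h : IsPoly m k R p)
    (α : Option (Fin m) → ℝ) (hα : ∀ o, |α o| ≤ 1) :
    IsPoly m (k + 1) R (fun x => (∑ o, α o * xo x o) * p x) := by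
  obtain ⟨c, h1, h2⟩ := h
  refine ⟨fun e => α (e 0) * c (Fin.tail e), fun e => ?_, fun x => ?_⟩
  · rw [abs_mul]
    exact (mul_le_of_le_one_left (abs_nonneg _) (hα _)).trans (h1 _)
  · beta_reduce
    rw [h2, ← Equiv.sum_comp (Fin.consEquiv fun _ : Fin (k + 1) => Option (Fin m)),
      Fintype.sum_prod_type, Finset.sum_mul]
    refine Finset.sum_congr rfl fun o _ => ?_
    rw [Finset.mul_sum]
    refine Finset.sum_congr rfl fun e _ => ?_
    simp [Fin.consEquiv, Fin.prod_univ_succ]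
    ring

lemma IsPoly.raise {m k : ℕ} {R : ℝ} {p : (Fin m → ℝ) → ℝ} (h : IsPoly m k R p) :
    IsPoly m (k + 1) R p := by
  have := h.affine (fun o => if o = none then 1 else 0) (by intro o; split_ifs <;> simp)
  simpa [xo] using this

lemma IsPoly.raise_le {m k k' : ℕ} {R : ℝ} {p : (Fin m → ℝ) → ℝ} (h : IsPoly m k R p)
    (hk : k ≤ k') : IsPoly m k' R p := by
  induction k', hk using Nat.le_induction with
  | base => exact h
  | succ n _ ih => exact ih.raise

lemma IsPoly.mulsub {m k : ℕ} {R : ℝ} {p : (Fin m → ℝ) → ℝ} (h : IsPoly m k R p)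
    (i : Fin m) (b : ℝ) (hb : |b| ≤ 1) : IsPoly m (k + 1) R (fun x => (x i - b) * p x) := by
  have := h.affine (fun o => if o = none then -b else if o = some i then 1 else 0)
    (by intro o; split_ifs <;> simp [hb])
  simp only [Fintype.sum_option] at this
  have e : ∀ x : Fin m → ℝ, -b + x i = x i - b := fun x => by ring
  simpa [xo, e] using this

lemma IsPoly.sum {m k : ℕ} {A : Type} (S : Finset A) {R : A → ℝ} {p : A → (Fin m → ℝ) → ℝ}
    (h : ∀ a ∈ S, IsPoly m k (R a) (p a)) :
    IsPoly m k (∑ a ∈ S, R a) (fun x => ∑ a ∈ S, p a x) := by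
  classical
  have h' : ∀ a, ∃ c : (Fin k → Option (Fin m)) → ℝ, a ∈ S → (∀ e, |c e| ≤ R a) ∧
      ∀ x, p a x = ∑ e, c e * ∏ j, xo x (e j) := by
    intro a
    by_cases ha : a ∈ S
    · obtain ⟨c, hc⟩ := h a ha
      exact ⟨c, fun _ => hc⟩
    · exact ⟨fun _ => 0, fun hh => absurd hh ha⟩
  choose c hc using h'
  refine ⟨fun e => ∑ a ∈ S, c a e, fun e => (Finset.abs_sum_le_sum_abs _ _).trans
    (Finset.sum_le_sum fun a ha => (hc a ha).1 e), fun x => ?_⟩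
  simp only [Finset.sum_mul]
  rw [Finset.sum_comm]
  exact Finset.sum_congr rfl fun a ha => (hc a ha).2 x

lemma IsPoly.smul {m k : ℕ} {R : ℝ} {p : (Fin m → ℝ) → ℝ} (h : IsPoly m k R p)
    (t : ℝ) (ht : |t| ≤ 1) : IsPoly m k R (fun x => t * p x) := by
  obtain ⟨c, h1, h2⟩ := h
  refine ⟨fun e => t * c e, fun e => ?_, fun x => ?_⟩
  · rw [abs_mul]
    exact (mul_le_of_le_one_left (abs_nonneg _) ht).trans (h1 _)
  · beta_reduce
    rw [h2, Finset.mul_sum]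
    exact Finset.sum_congr rfl fun e _ => by ring

lemma DT_poly {m : ℕ} {r lam : ℝ} {a : Fin m → ℝ} (ha : a ∈ cube m) (j : ℕ) :
    ∀ k, j ≤ k → ∀ g : (Fin m → ℝ) → ℝ, HC m k r lam g →
      IsPoly m j (m ^ j * r) (fun x => DT m j g a (x - a)) := by
  induction j with
  | zero =>
    intro k _ g hg
    simp only [DT, pow_zero, one_mul]
    exact IsPoly.const m r (g a) (hg.bdd a ha)
  | succ j ih =>
    intro k hk g hg
    obtain ⟨k, rfl⟩ : ∃ k', k = k' + 1 := ⟨k - 1, by omega⟩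
    have h1 := IsPoly.sum (Finset.univ : Finset (Fin m)) (k := j + 1) (R := fun _ => m ^ j * r)
      (p := fun i x => (x i - a i) * DT m j (pderivW m i g) a (x - a))
      (fun i _ => (ih k (by omega) _ (hg.pd i)).mulsub i (a i)
        (by rw [abs_of_nonneg (ha i).1]; exact (ha i).2))
    simp only [Finset.sum_const, Finset.card_univ, Fintype.card_fin, nsmul_eq_mul] at h1
    simp only [DT, Pi.sub_apply]
    rw [pow_succ', mul_assoc]
    exact h1

lemma Tay_poly {m k : ℕ} {r lam : ℝ} {a : Fin m → ℝ} (ha : a ∈ cube m)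
    {g : (Fin m → ℝ) → ℝ} (hg : HC m k r lam g) :
    IsPoly m k (∑ j ∈ Finset.range (k + 1), (m : ℝ) ^ j * r) (fun x => Tay m k g a 1 (x - a)) := by
  unfold Tay
  refine IsPoly.sum _ fun j hj => ?_
  have hj' : j ≤ k := by simp at hj; omega
  refine ((DT_poly ha j k hj' g hg).raise_le hj').smul _ ?_
  rw [one_pow, abs_of_nonneg (by positivity)]
  exact div_le_one_of_le₀ (by exact_mod_cast Nat.factorial_pos j) (by positivity)

/-! ### Approximation of Hölder functions -/

lemma lincomb_net {A : Type} [Fintype A] [Nonempty A] {m w0 L0 s0 ρ : ℕ} (hw0 : 2 ≤ w0)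
    {f : A → (Fin m → ℝ) → ℝ} (hL : 1 ≤ L0)
    (hf : ∀ a, SNet w0 L0 s0 (Fin m) (f a)) (c : A → ℝ) (hc : ∀ a, |c a| ≤ 2 ^ ρ) :
    SNet (Fintype.card A * w0) (L0 + 1 + (1 + 2 * ρ))
      (Fintype.card A * s0 + Fintype.card A + (1 + 2 * ρ) * 6) (Fin m)
      (fun x => max (∑ a, c a * f a x) 0) := by
  have hρ : (0 : ℝ) < 2 ^ ρ := by positivity
  have h1 := SNet.par hL hf
  simp only [Finset.sum_const, Finset.card_univ, smul_eq_mul] at h1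
  have hN : 1 ≤ Fintype.card A := Fintype.card_pos
  have hW : 2 ≤ Fintype.card A * w0 := by nlinarith
  have h2 := SNet.neuron0 (ι := A) (fun a => c a / 2 ^ ρ)
    (fun a => by rw [abs_div, abs_of_pos hρ]; exact div_le_one_of_le₀ (hc a) hρ.le)
    (w := Fintype.card A * w0) (by omega)
  have h3 := ((CNet.coord (ι := Unit) () 0).mono (w' := 2) (by omega)).dblIter le_rfl (by omega) ρ
  have h4 : SNet 2 (1 + 2 * ρ) ((1 + 2 * ρ) * 6) Unit (fun x => 2 ^ ρ * max (x ()) 0) := by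
    have := h3.sNet (by simp)
    simpa using this
  have h5 := (h1.scomp h2).then (h4.mono hW le_rfl)
  refine Net.congr h5 fun x _ => ?_
  beta_reduce
  rw [max_eq_left (le_max_right _ _), mul_max_of_nonneg _ _ hρ.le, mul_zero, Finset.mul_sum]
  congr 1
  refine Finset.sum_congr rfl fun a _ => ?_
  field_simp

/-- The basis functions: product of a localized hat and a monomial. -/
def basisFn {m k : ℕ} (n : ℕ) (a : Fin m → Fin (2 ^ n + 1)) (e : Fin k → Option (Fin m))
    (x : Fin m → ℝ) : ℝ :=
  (∏ i, hat (2 ^ n * x i - (a i : ℕ))) * ∏ j, xo x (e j)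

lemma basis_net {m k : ℕ} (n t : ℕ) (a : Fin m → Fin (2 ^ n + 1)) (e : Fin k → Option (Fin m)) :
    ∃ P : (Fin m → ℝ) → ℝ, CNet ((m + k) * 2 + 7) (2 * n + 2 + (m + k) * (t + 6)) (Fin m) P ∧
      ∀ x ∈ cube m, |P x - basisFn n a e x| ≤ (m + k) * (1 / 4) ^ t := by
  let f : Fin (m + k) → (Fin m → ℝ) → ℝ := fun j => Fin.addCases
    (fun i x => hat (2 ^ n * x i - (a i : ℕ)))
    (fun j x => match e j with
      | none => 1
      | some i => max (x i) 0) j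
  have hf : ∀ j, CNet 2 (2 * n + 2) (Fin m) (f j) := by
    intro j
    refine Fin.addCases (fun i => ?_) (fun j => ?_) j
    · simp only [f, Fin.addCases_left]
      exact CNet.hat i n _ (by have := (a i).2; omega)
    · simp only [f, Fin.addCases_right]
      cases e j with
      | none => exact (CNet.one (2 * n + 1)).mono (by omega)
      | some i => exact (CNet.coord i (2 * n + 1)).mono (by omega)
  obtain ⟨P, hP, -, -, hPe⟩ := prod_net t 2 (2 * n + 2) (by omega) (by omega) (m + k) f hf
  refine ⟨P, hP, fun x hx => ?_⟩
  have e1 : ∏ j, f j x = basisFn n a e x := by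
    rw [Fin.prod_univ_add]
    unfold basisFn
    congr 1
    · simp [f]
    · refine Finset.prod_congr rfl fun j _ => ?_
      simp only [f, Fin.addCases_right]
      cases e j with
      | none => rfl
      | some i => simp [xo, (hx i).1]
  have h01 : ∀ j, 0 ≤ f j x ∧ f j x ≤ 1 := by
    intro j
    refine Fin.addCases (fun i => ?_) (fun j => ?_) j
    · simp only [f, Fin.addCases_left]
      exact ⟨hat_nonneg _, hat_le_one _⟩
    · simp only [f, Fin.addCases_right]
      cases e j with
      | none => simp
      | some i => simp [(hx i).2]
  have := hPe x (fun j => (h01 j).1) (fun j => (h01 j).2)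
  rw [e1] at this
  exact_mod_cast this

lemma localized_taylor {m k : ℕ} {r lam R : ℝ} (hr : 0 ≤ r) (hlam : 0 ≤ lam) (n : ℕ)
    (hR : ∑ j ∈ Finset.range (k + 1), (m : ℝ) ^ j * r ≤ R)
    {g : (Fin m → ℝ) → ℝ} (hg : HC m k r lam g) :
    ∃ c : (Fin m → Fin (2 ^ n + 1)) × (Fin k → Option (Fin m)) → ℝ, (∀ a, |c a| ≤ R) ∧
      ∀ x ∈ cube m, |g x - ∑ a, c a * basisFn n a.1 a.2 x| ≤
        (m * (1 / 2) ^ n) ^ k * (r * (m * (1 / 2) ^ n) ^ lam) := by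
  let pt : (Fin m → Fin (2 ^ n + 1)) → Fin m → ℝ := fun a i => ((a i : ℕ) : ℝ) / 2 ^ n
  have hpt : ∀ a, pt a ∈ cube m := by
    intro a i
    refine ⟨by positivity, div_le_one_of_le₀ ?_ (by positivity)⟩
    have := (a i).2
    exact_mod_cast (by omega : (a i : ℕ) ≤ 2 ^ n)
  have hpoly := fun a => (Tay_poly (hpt a) hg).mono hR
  choose c hc hce using hpoly
  refine ⟨fun a => c a.1 a.2, fun a => hc _ _, fun x hx => ?_⟩
  have e1 : ∑ a : (Fin m → Fin (2 ^ n + 1)) × (Fin k → Option (Fin m)),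
      c a.1 a.2 * basisFn n a.1 a.2 x = ∑ a : Fin m → Fin (2 ^ n + 1),
        (∏ i, hat (2 ^ n * x i - (a i : ℕ))) * Tay m k g (pt a) 1 (x - pt a) := by
    rw [Fintype.sum_prod_type]
    refine Finset.sum_congr rfl fun a _ => ?_
    have := hce a x
    beta_reduce at this
    rw [this, Finset.mul_sum]
    refine Finset.sum_congr rfl fun e _ => ?_
    unfold basisFn
    ring
  have e2 : g x = ∑ a : Fin m → Fin (2 ^ n + 1),
      (∏ i, hat (2 ^ n * x i - (a i : ℕ))) * g x := by
    rw [← Finset.sum_mul, hat_partition n x hx, one_mul]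
  rw [e1]
  nth_rw 1 [e2]
  rw [← Finset.sum_sub_distrib]
  set E := (m * (1 / 2) ^ n) ^ k * (r * ((m : ℝ) * (1 / 2) ^ n) ^ lam)
  calc _ ≤ ∑ a : Fin m → Fin (2 ^ n + 1), |(∏ i, hat (2 ^ n * x i - (a i : ℕ))) * g x
        - (∏ i, hat (2 ^ n * x i - (a i : ℕ))) * Tay m k g (pt a) 1 (x - pt a)| :=
        Finset.abs_sum_le_sum_abs _ _
    _ ≤ ∑ a : Fin m → Fin (2 ^ n + 1), (∏ i, hat (2 ^ n * x i - (a i : ℕ))) * E := by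
        refine Finset.sum_le_sum fun a _ => ?_
        have hn : 0 ≤ ∏ i, hat (2 ^ n * x i - (a i : ℕ)) :=
          Finset.prod_nonneg fun i _ => hat_nonneg _
        rw [← mul_sub, abs_mul, abs_of_nonneg hn]
        by_cases h0 : ∏ i, hat (2 ^ n * x i - (a i : ℕ)) = 0
        · simp [h0]
        · refine mul_le_mul_of_nonneg_left ?_ hn
          have hcl : ∀ i, |(x - pt a) i| ≤ (1 / 2) ^ n := by
            intro i
            exact hat_support ((Finset.prod_ne_zero_iff.1 h0) i (Finset.mem_univ i))
          have := Tay_bound hr hlam (by positivity) (hpt a) (h := x - pt a) (by simpa using hx)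
            hcl k g hg 1 (by simp)
          rw [one_smul, add_sub_cancel] at this
          exact this
    _ = E := by rw [← Finset.sum_mul, hat_partition n x hx, one_mul]

lemma holder_net_pre {m k ρ : ℕ} {r lam : ℝ} (hr : 0 ≤ r) (hlam : 0 ≤ lam) (n t : ℕ)
    (hR : ∑ j ∈ Finset.range (k + 1), (m : ℝ) ^ j * r ≤ 2 ^ ρ)
    {g : (Fin m → ℝ) → ℝ} (hg : HC m k r lam g) (N w0 L0 : ℕ)
    (hN : N = (2 ^ n + 1) ^ m * (m + 1) ^ k) (hw0 : w0 = (m + k) * 2 + 7)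
    (hL0 : L0 = 2 * n + 2 + (m + k) * (t + 6)) :
    ∃ p q : (Fin m → ℝ) → ℝ,
      SNet (N * w0) (L0 + 1 + (1 + 2 * ρ))
        (N * (L0 * (w0 * (w0 + 1))) + N + (1 + 2 * ρ) * 6) (Fin m) p ∧
      SNet (N * w0) (L0 + 1 + (1 + 2 * ρ))
        (N * (L0 * (w0 * (w0 + 1))) + N + (1 + 2 * ρ) * 6) (Fin m) q ∧
      ∀ x ∈ cube m, |g x - (p x - q x)| ≤
        (m * (1 / 2) ^ n) ^ k * (r * (m * (1 / 2) ^ n) ^ lam)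
          + N * (2 ^ ρ * ((m + k) * (1 / 4) ^ t)) := by
  obtain ⟨c, hc, hce⟩ := localized_taylor hr hlam n hR hg
  have hP := fun a : (Fin m → Fin (2 ^ n + 1)) × (Fin k → Option (Fin m)) =>
    basis_net n t a.1 a.2
  choose P hPn hPe using hP
  have hcard : Fintype.card ((Fin m → Fin (2 ^ n + 1)) × (Fin k → Option (Fin m))) = N := by
    rw [hN]; simp
  subst hw0 hL0
  have hs := fun a => (hPn a).sNet (by simp; omega)
  have hp := lincomb_net (ρ := ρ) (by omega) (by omega) hs c hc
  have hq := lincomb_net (ρ := ρ) (by omega) (by omega) hs (fun a => - c a)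
    (fun a => by rw [abs_neg]; exact hc a)
  rw [hcard] at hp hq
  refine ⟨_, _, hp, hq, fun x hx => ?_⟩
  have e1 : max (∑ a, c a * P a x) 0 - max (∑ a, -c a * P a x) 0 = ∑ a, c a * P a x := by
    simp only [neg_mul, Finset.sum_neg_distrib]
    set u := ∑ a, c a * P a x
    rcases le_total 0 u with h | h
    · rw [max_eq_left h, max_eq_right (by linarith)]; ring
    · rw [max_eq_right h, max_eq_left (by linarith)]; ring
  rw [e1]
  have e2 : |∑ a, c a * basisFn n a.1 a.2 x - ∑ a, c a * P a x| ≤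
      N * (2 ^ ρ * ((m + k) * (1 / 4) ^ t)) := by
    rw [← Finset.sum_sub_distrib]
    calc _ ≤ ∑ a, |c a * basisFn n a.1 a.2 x - c a * P a x| := Finset.abs_sum_le_sum_abs _ _
      _ ≤ ∑ _a : (Fin m → Fin (2 ^ n + 1)) × (Fin k → Option (Fin m)),
          (2 : ℝ) ^ ρ * ((m + k) * (1 / 4) ^ t) := by
          refine Finset.sum_le_sum fun a _ => ?_
          rw [← mul_sub, abs_mul, abs_sub_comm]
          exact mul_le_mul (hc a) (hPe a x hx) (abs_nonneg _) (by positivity)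
      _ = _ := by
          rw [Finset.sum_const, Finset.card_univ, hcard, nsmul_eq_mul]
  have := abs_sub_le (g x) (∑ a, c a * basisFn n a.1 a.2 x) (∑ a, c a * P a x)
  linarith [hce x hx]

lemma log_inv_ge {δ : ℝ} (h0 : 0 < δ) (h1 : δ ≤ 1 / 2) : 1 / 2 ≤ Real.log (1 / δ) := by
  have h2 : (2 : ℝ) ≤ 1 / δ := by rw [le_div_iff₀ h0]; linarith
  have := Real.log_le_log (by norm_num) h2
  linarith [Real.log_two_gt_d9]

lemma rpow_neg_ge {δ a : ℝ} (h0 : 0 < δ) (h1 : δ ≤ 1 / 2) (ha : 0 ≤ a) : 1 ≤ δ ^ (-a) :=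
  Real.one_le_rpow_of_pos_of_le_one_of_nonpos h0 (by linarith) (by linarith)

lemma exp_bound {C a : ℝ} (hC : 0 < C) (ha : 0 ≤ a) : ∃ C' : ℝ, 0 < C' ∧
    ∀ δ : ℝ, 0 < δ → δ ≤ 1 / 2 → ∀ n : ℕ, (2 : ℝ) ^ n ≤ C * δ ^ (-a) →
      (n : ℝ) ≤ C' * Real.log (1 / δ) := by
  refine ⟨2 * (2 * |Real.log C| + a) + 1, by positivity, fun δ h0 h1 n hn => ?_⟩
  have hl := log_inv_ge h0 h1
  have h2 := Real.log_le_log (by positivity) hn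
  have hp : 0 < δ ^ (-a) := Real.rpow_pos_of_pos h0 _
  rw [Real.log_pow, Real.log_mul hC.ne' hp.ne', Real.log_rpow h0] at h2
  have e : Real.log (1 / δ) = - Real.log δ := by rw [one_div, Real.log_inv]
  rw [e] at hl ⊢
  set ℓ := -Real.log δ with hℓ
  have h3 : -a * Real.log δ = a * ℓ := by rw [hℓ]; ring
  rw [h3] at h2
  have h4 := Real.log_two_gt_d9
  have h5 := le_abs_self (Real.log C)
  have h6 := abs_nonneg (Real.log C)
  have hn0 : (0 : ℝ) ≤ n := by positivity
  have h7 : (n : ℝ) * (1 / 2) ≤ n * Real.log 2 := mul_le_mul_of_nonneg_left (by linarith) hn0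
  have h8 : |Real.log C| * (1 / 2) ≤ |Real.log C| * ℓ := mul_le_mul_of_nonneg_left hl h6
  nlinarith

set_option maxHeartbeats 1000000 in
lemma holder_net (m : ℕ) (hm : 0 < m) (β r : ℝ) (hβ : 0 < β) (hr : 0 < r) :
    ∃ C : ℝ, 0 < C ∧ ∀ δ : ℝ, 0 < δ → δ ≤ 1 / 2 → ∃ w L s : ℕ, 1 ≤ w ∧ 1 ≤ L ∧
      (L : ℝ) ≤ C * Real.log (1 / δ) ∧ (w : ℝ) ≤ C * δ ^ (-((m : ℝ) / β)) ∧
      (s : ℝ) ≤ C * δ ^ (-((m : ℝ) / β)) * Real.log (1 / δ) ∧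
      ∀ g, MemHolderBall m β r g → ∃ p q : (Fin m → ℝ) → ℝ,
        SNet w L s (Fin m) p ∧ SNet w L s (Fin m) q ∧
        ∀ x ∈ cube m, |g x - (p x - q x)| ≤ δ := by
  set k := ⌈β⌉₊ - 1 with hk
  set lam := β - (⌈β⌉₊ : ℝ) + 1 with hlam
  have hc1 : 1 ≤ ⌈β⌉₊ := Nat.one_le_iff_ne_zero.2 (by simpa using hβ)
  have hkl : (k : ℝ) + lam = β := by
    rw [hk, hlam, Nat.cast_sub hc1]; push_cast; ring
  have hlam0 : 0 ≤ lam := by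
    have := Nat.ceil_lt_add_one hβ.le
    rw [hlam]; linarith
  obtain ⟨ρ, hρ⟩ : ∃ ρ : ℕ, ∑ j ∈ Finset.range (k + 1), (m : ℝ) ^ j * r ≤ 2 ^ ρ :=
    (pow_unbounded_of_one_lt _ (by norm_num : (1 : ℝ) < 2)).imp fun _ h => h.le
  have hm1 : (1 : ℝ) ≤ m := by exact_mod_cast hm
  -- the constants
  set b : ℝ := m * (2 * r) ^ (1 / β) with hb
  have hb0 : 0 < b := by positivity
  set C1 : ℝ := 2 * (b + 1) + 1 with hC1
  obtain ⟨Cn, hCn0, hCn⟩ := exp_bound (C := C1) (a := 1 / β) (by positivity) (by positivity)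
  set C2 : ℝ := C1 ^ m * (m + 1) ^ k with hC2
  have hC20 : 0 < C2 := by positivity
  set C3 : ℝ := 2 * (C2 * (2 ^ ρ * (m + k))) + 1 with hC3
  have hC30 : 0 < C3 := by positivity
  obtain ⟨Ct, hCt0, hCt⟩ := exp_bound (C := C3) (a := m / β + 1) (by positivity) (by positivity)
  set w0 : ℕ := (m + k) * 2 + 7 with hw0
  set CL : ℝ := 2 * (Cn + 1) + (m + k) * (Ct + 14) + 4 + 2 * (2 + 2 * ρ) with hCL
  have hCL0 : 0 < CL := by positivity
  set C : ℝ := CL + C2 * w0 + (C2 * CL * (w0 * (w0 + 1)) + 2 * C2 + 12 * (1 + 2 * ρ)) with hC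
  refine ⟨C, by positivity, fun δ h0 h1 => ?_⟩
  have hl := log_inv_ge h0 h1
  set ℓ := Real.log (1 / δ) with hℓ
  have hD1 : 1 ≤ δ ^ (-(1 / β)) := rpow_neg_ge h0 h1 (by positivity)
  have hDm : 1 ≤ δ ^ (-((m : ℝ) / β)) := rpow_neg_ge h0 h1 (by positivity)
  set X : ℝ := b * δ ^ (-(1 / β)) with hX
  have hX0 : 0 < X := by positivity
  obtain ⟨n', hn1, hn2⟩ := exists_nat_pow_near (x := X + 1) (y := (2 : ℝ)) (by linarith)
    (by norm_num)
  have hn3 : (2 : ℝ) ^ (n' + 1) + 1 ≤ C1 * δ ^ (-(1 / β)) := by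
    rw [pow_succ]
    have : C1 * δ ^ (-(1 / β)) = 2 * X + 3 * δ ^ (-(1 / β)) := by rw [hC1, hX]; ring
    rw [this]; linarith
  set n := n' + 1 with hn
  have hnb := hCn δ h0 h1 n (by linarith)
  have hNb : (((2 ^ n + 1) ^ m * (m + 1) ^ k : ℕ) : ℝ) ≤ C2 * δ ^ (-((m : ℝ) / β)) := by
    push_cast
    have e : δ ^ (-((m : ℝ) / β)) = (δ ^ (-(1 / β))) ^ m := by
      rw [← Real.rpow_natCast, ← Real.rpow_mul h0.le]; congr 1; ring
    rw [e, hC2, mul_right_comm, ← mul_pow]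
    refine mul_le_mul_of_nonneg_right ?_ (by positivity)
    exact pow_le_pow_left₀ (by positivity) hn3 m
  set Y : ℝ := C3 * δ ^ (-((m : ℝ) / β + 1)) with hY
  have hDy : 1 ≤ δ ^ (-((m : ℝ) / β + 1)) := rpow_neg_ge h0 h1 (by positivity)
  have hC31 : 1 ≤ C3 := by
    rw [hC3]; have : 0 ≤ C2 * (2 ^ ρ * ((m : ℝ) + k)) := by positivity
    linarith
  obtain ⟨t', ht1, ht2⟩ := exists_nat_pow_near (x := Y) (y := (4 : ℝ)) (by nlinarith)
    (by norm_num)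
  have htb := hCt δ h0 h1 t' (le_trans (pow_le_pow_left₀ (by norm_num) (by norm_num) t') ht1)
  set t := t' + 1 with ht
  set N : ℕ := (2 ^ n + 1) ^ m * (m + 1) ^ k with hN
  set L0 : ℕ := 2 * n + 2 + (m + k) * (t + 6) with hL0
  have hw1 : 1 ≤ N * w0 := Nat.mul_pos (by positivity) (by omega)
  have hLb : ((L0 + 1 + (1 + 2 * ρ) : ℕ) : ℝ) ≤ CL * ℓ := by
    rw [hL0, ht, hCL]
    push_cast
    have e1 : ((m : ℝ) + k) * (t' + 1 + 6) ≤ (m + k) * ((Ct + 14) * ℓ) := by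
      refine mul_le_mul_of_nonneg_left ?_ (by positivity)
      rw [add_mul]
      linarith
    have e2 : (ρ : ℝ) * (1 / 2) ≤ ρ * ℓ := mul_le_mul_of_nonneg_left hl (by positivity)
    have e3 : (2 * (Cn + 1) + ((m : ℝ) + k) * (Ct + 14) + 4 + 2 * (2 + 2 * ρ)) * ℓ
        = 2 * (Cn * ℓ) + 2 * ℓ + (m + k) * ((Ct + 14) * ℓ) + 4 * ℓ + 4 * ℓ + 4 * (ρ * ℓ) := by
      ring
    rw [e3]
    linarith
  refine ⟨N * w0, L0 + 1 + (1 + 2 * ρ),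
    N * (L0 * (w0 * (w0 + 1))) + N + (1 + 2 * ρ) * 6, hw1, by omega, ?_, ?_, ?_, fun g hg => ?_⟩
  rotate_left 3
  · obtain ⟨p, q, hp, hq, hpq⟩ := holder_net_pre hr.le hlam0 n t hρ (hg.hc hm) N w0 L0 hN hw0 hL0
    refine ⟨p, q, hp, hq, fun x hx => (hpq x hx).trans ?_⟩
    have e1 : ((m : ℝ) * (1 / 2) ^ n) ^ k * (r * (m * (1 / 2) ^ n) ^ lam) ≤ δ / 2 := by
      have hpos : 0 < (m : ℝ) * (1 / 2) ^ n := by positivity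
      have e2 : ((m : ℝ) * (1 / 2) ^ n) ^ k * (r * (m * (1 / 2) ^ n) ^ lam)
          = r * (m * (1 / 2) ^ n) ^ β := by
        rw [← hkl, Real.rpow_add hpos (k : ℝ) lam, Real.rpow_natCast]; ring
      rw [e2]
      have e3 : (m : ℝ) * (1 / 2) ^ n ≤ (δ / (2 * r)) ^ (1 / β) := by
        rw [one_div, inv_pow, ← div_eq_mul_inv, div_le_iff₀ (by positivity)]
        have e4 : (m : ℝ) = (δ / (2 * r)) ^ (1 / β) * X := by
          rw [hX, hb, Real.div_rpow h0.le (by positivity), Real.rpow_neg h0.le]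
          have : δ ^ (1 / β) ≠ 0 := by positivity
          have : (2 * r) ^ (1 / β) ≠ 0 := by positivity
          field_simp
        calc (m : ℝ) = (δ / (2 * r)) ^ (1 / β) * X := e4
          _ ≤ _ := by
            rw [one_div]
            exact mul_le_mul_of_nonneg_left (by linarith) (by positivity)
      calc r * ((m : ℝ) * (1 / 2) ^ n) ^ β ≤ r * ((δ / (2 * r)) ^ (1 / β)) ^ β :=
            mul_le_mul_of_nonneg_left (Real.rpow_le_rpow hpos.le e3 hβ.le) hr.le
        _ = δ / 2 := by
            rw [← Real.rpow_mul (by positivity), one_div_mul_cancel hβ.ne', Real.rpow_one]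
            field_simp
    have e2 : (N : ℝ) * (2 ^ ρ * ((m + k) * (1 / 4) ^ t)) ≤ δ / 2 := by
      have h4 : (0 : ℝ) < 4 ^ t := by positivity
      rw [one_div, inv_pow]
      have e3 : (N : ℝ) * (2 ^ ρ * ((m + k) * (4 ^ t)⁻¹)) = N * (2 ^ ρ * (m + k)) / 4 ^ t := by
        field_simp
      rw [e3, div_le_iff₀ h4]
      have e4 : δ ^ (-((m : ℝ) / β)) = δ * δ ^ (-((m : ℝ) / β + 1)) := by
        rw [← Real.rpow_one_add' h0.le]
        · congr 1; ring
        · have : 0 < (m : ℝ) / β := by positivity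
          intro h; linarith
      calc (N : ℝ) * (2 ^ ρ * (m + k)) ≤ C2 * δ ^ (-((m : ℝ) / β)) * (2 ^ ρ * (m + k)) :=
            mul_le_mul_of_nonneg_right hNb (by positivity)
        _ = δ / 2 * ((C3 - 1) * δ ^ (-((m : ℝ) / β + 1))) := by rw [e4, hC3]; ring
        _ ≤ δ / 2 * Y := by
            refine mul_le_mul_of_nonneg_left ?_ (by linarith)
            rw [hY]
            exact mul_le_mul_of_nonneg_right (by linarith) (by positivity)
        _ ≤ δ / 2 * 4 ^ t := mul_le_mul_of_nonneg_left ht2.le (by linarith)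
    linarith
  · refine hLb.trans (mul_le_mul_of_nonneg_right ?_ (by linarith))
    rw [hC, add_assoc]
    exact le_add_of_nonneg_right (by positivity)
  · push_cast
    calc (N : ℝ) * w0 ≤ C2 * δ ^ (-((m : ℝ) / β)) * w0 :=
          mul_le_mul_of_nonneg_right hNb (by positivity)
      _ = C2 * w0 * δ ^ (-((m : ℝ) / β)) := by ring
      _ ≤ _ := by
        refine mul_le_mul_of_nonneg_right ?_ (by positivity)
        rw [hC, add_right_comm]
        exact le_add_of_nonneg_left (by positivity)
  · set D := δ ^ (-((m : ℝ) / β)) with hD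
    have hL0b : (L0 : ℝ) ≤ CL * ℓ := by
      refine le_trans ?_ hLb
      push_cast
      have : (0 : ℝ) ≤ ρ := by positivity
      linarith
    have hN0 : (0 : ℝ) ≤ N := by positivity
    have hℓ0 : 0 ≤ ℓ := by linarith
    have a1 : (N : ℝ) * (L0 * (w0 * (w0 + 1))) ≤ (C2 * D) * (CL * ℓ * (w0 * (w0 + 1))) := by
      refine mul_le_mul hNb ?_ (by positivity) (by positivity)
      exact mul_le_mul_of_nonneg_right hL0b (by positivity)
    have hDl : 1 ≤ 2 * (D * ℓ) := by nlinarith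
    have a2 : (N : ℝ) ≤ 2 * C2 * (D * ℓ) := by
      refine hNb.trans ?_
      have : C2 * D ≤ C2 * (D * (2 * ℓ)) := by
        refine mul_le_mul_of_nonneg_left ?_ hC20.le
        exact le_mul_of_one_le_right (by linarith) (by linarith)
      linarith
    have a3 : (1 + 2 * (ρ : ℝ)) * 6 ≤ 12 * (1 + 2 * ρ) * (D * ℓ) := by
      have : (0 : ℝ) ≤ (1 + 2 * ρ) * 6 := by positivity
      have := mul_le_mul_of_nonneg_left hDl this
      linarith
    push_cast
    calc _ ≤ (C2 * D) * (CL * ℓ * (w0 * (w0 + 1))) + 2 * C2 * (D * ℓ)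
          + 12 * (1 + 2 * ρ) * (D * ℓ) := by linarith
      _ = (C2 * CL * (w0 * (w0 + 1)) + 2 * C2 + 12 * (1 + 2 * ρ)) * (D * ℓ) := by ring
      _ ≤ C * (D * ℓ) := by
        refine mul_le_mul_of_nonneg_right ?_ (by positivity)
        rw [hC]
        exact le_add_of_nonneg_left (by positivity)
      _ = _ := by ring

lemma holder_modulus (m : ℕ) (hm : 0 < m) (β r : ℝ) (hβ : 0 < β) (hr : 0 < r) :
    ∃ C : ℝ, 0 < C ∧ ∀ g, MemHolderBall m β r g → ∀ s : ℝ, 0 ≤ s → ∀ x ∈ cube m, ∀ z ∈ cube m,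
      (∀ i, |x i - z i| ≤ s) → |g x - g z| ≤ C * s ^ (min 1 β) := by
  refine ⟨r * m ^ (min 1 β), by positivity, fun g hg s hs x hx z hz h => ?_⟩
  have hlam0 : 0 ≤ β - (⌈β⌉₊ : ℝ) + 1 := by
    have := Nat.ceil_lt_add_one hβ.le
    linarith
  have := (hg.hc hm).modulus (θ := min 1 β) hr.le hs hlam0 ?_ hx hz h
  · rwa [Real.mul_rpow (by positivity) hs, ← mul_assoc] at this
  · rcases le_or_gt β 1 with h1 | h1
    · left
      have : ⌈β⌉₊ = 1 := by
        apply le_antisymm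
        · exact Nat.ceil_le.2 (by simpa using h1)
        · exact Nat.one_le_iff_ne_zero.2 (by simpa using hβ)
      rw [this, min_eq_right h1]
      simp
    · right
      have : 1 < ⌈β⌉₊ := Nat.lt_ceil.2 (by simpa using h1)
      exact ⟨by omega, min_eq_left h1.le⟩

/-! ### Maximum networks and coordinate functions -/

lemma max_net {ι : Type} [Fintype ι] [DecidableEq ι] (t : ℕ) : ∀ (I : Finset ι) (hI : I.Nonempty),
    I.card ≤ 2 ^ t →
    SNet (2 ^ t) (2 * t + 1) (9 * 2 ^ t - 8) ι (fun x => max (I.sup' hI fun i => x i) 0) := by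
  induction t with
  | zero =>
    intro I hI hc
    obtain ⟨i, rfl⟩ := Finset.card_eq_one.1 (le_antisymm (by simpa using hc) hI.card_pos)
    have := Net.copy (ι := ι) (κ := Unit) (fun _ => i) (w := 1) (by simp)
    simpa [SNet] using this
  | succ t ih =>
    intro I hI hc
    obtain ⟨I1, I2, h1, h2, hu, hc1, hc2⟩ : ∃ I1 I2 : Finset ι, I1.Nonempty ∧ I2.Nonempty ∧
        I = I1 ∪ I2 ∧ I1.card ≤ 2 ^ t ∧ I2.card ≤ 2 ^ t := by
      have h2t : 0 < 2 ^ t := by positivity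
      by_cases hle : I.card ≤ 2 ^ t
      · exact ⟨I, I, hI, hI, by simp, hle, hle⟩
      · obtain ⟨I1, hs, hcI⟩ := Finset.exists_subset_card_eq (by omega : 2 ^ t ≤ I.card)
        have hd := Finset.card_sdiff_of_subset hs
        rw [pow_succ] at hc
        refine ⟨I1, I \ I1, Finset.card_pos.1 (by omega), Finset.card_pos.1 (by omega), ?_,
          by omega, by omega⟩
        exact (Finset.union_sdiff_of_subset hs).symm
    subst hu
    have hp := SNet.par (A := Bool) (w := fun _ => 2 ^ t) (L := 2 * t + 1) (by omega)
      (s := fun _ => 9 * 2 ^ t - 8)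
      (f := fun b x => if b then max (I1.sup' h1 fun i => x i) 0
        else max (I2.sup' h2 fun i => x i) 0)
      (by intro b; cases b <;> simp only [if_true, Bool.false_eq_true, if_false]
          · exact ih I2 h2 hc2
          · exact ih I1 h1 hc1)
    have hW : 2 ≤ 2 ^ (t + 1) := by rw [pow_succ]; have : 0 < 2 ^ t := by positivity
                                    omega
    have hl1 := Net.layer (ι := Bool) (κ := Bool)
      (fun j i => if j then (if i then 1 else -1) else (if i then 0 else 1)) (fun _ => 0)
      (by intro j i; cases j <;> cases i <;> simp) (by simp) (w := 2 ^ (t + 1)) (by simpa using hW)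
    have hl2 := SNet.neuron0 (ι := Bool) (fun _ => 1) (by simp) (w := 2 ^ (t + 1)) (by omega)
    have hfin := ((Net.mono (w' := 2 ^ (t + 1)) (by simp [pow_succ]; omega) le_rfl hp).comp
      hl1).scomp hl2
    have e : 2 * (t + 1) + 1 = 2 * t + 1 + 1 + 1 := by ring
    rw [e]
    have hs : ∑ _b : Bool, (9 * 2 ^ t - 8) + Fintype.card Bool * (Fintype.card Bool + 1)
        + Fintype.card Bool ≤ 9 * 2 ^ (t + 1) - 8 := by
      simp [pow_succ]
      have : 0 < 2 ^ t := by positivity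
      omega
    refine Net.congr (SNet.mono hfin le_rfl hs) fun x _ => ?_
    simp only [Fintype.sum_bool, if_true, Bool.false_eq_true, if_false, one_mul, zero_mul,
      sub_zero, zero_add]
    rw [Finset.sup'_union h1 h2]
    set a := I1.sup' h1 fun i => x i
    set b := I2.sup' h2 fun i => x i
    have ha : 0 ≤ max a 0 := le_max_right _ _
    have hb : 0 ≤ max b 0 := le_max_right _ _
    have hab : max (a ⊔ b) 0 = max (max a 0) (max b 0) := by
      rw [max_max_max_comm, max_self]
    rw [hab]
    generalize max a 0 = u at *
    generalize max b 0 = v at *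
    rw [max_eq_left hb]
    rcases le_total u v with h | h
    · rw [max_eq_right h, max_eq_right (by linarith : u + -1 * v ≤ 0), zero_add, max_eq_left hb]
    · rw [max_eq_left h, max_eq_left (by linarith : (0 : ℝ) ≤ u + -1 * v)]
      rw [max_eq_left (by linarith)]; ring

lemma coord_net {m w L s t D dmax : ℕ} {β r δ : ℝ} (hw1 : 1 ≤ w) (hL1 : 1 ≤ L) (hδ : 0 ≤ δ)
    (hH : ∀ g, MemHolderBall m β r g → ∃ p q : (Fin m → ℝ) → ℝ,
        SNet w L s (Fin m) p ∧ SNet w L s (Fin m) q ∧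
        ∀ x ∈ cube m, |g x - (p x - q x)| ≤ δ)
    (ht : dmax ≤ 2 ^ t) {f : (Fin D → ℝ) → ℝ} (hf : GH D m β r f ∨ GM D dmax f) :
    ∃ F : (Fin D → ℝ) → Bool → ℝ,
      Net (2 * (w + m) + 2 ^ t) (1 + L + (2 * t + 1))
        (2 * (s + m + 9 * 2 ^ t + L + 2 * t + 2)) (Fin D) Bool F ∧
      ∀ x ∈ cube D, |f x - (F x true - F x false)| ≤ δ := by
  have key : ∃ p n : (Fin D → ℝ) → ℝ,
      SNet (w + m + 2 ^ t) (1 + L + (2 * t + 1)) (s + m + 9 * 2 ^ t + L + 2 * t + 2) (Fin D) p ∧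
      SNet (w + m) (1 + L + (2 * t + 1)) (s + m + 9 * 2 ^ t + L + 2 * t + 2) (Fin D) n ∧
      ∀ x ∈ cube D, |f x - (p x - n x)| ≤ δ := by
    rcases hf with ⟨I, hI, g, hg, hfg⟩ | ⟨I, hI, hc, hfI⟩
    · obtain ⟨p, n, hp, hn, hpn⟩ := hH g hg
      have hcopy := Net.copy (fun j => (I.orderIsoOfFin hI j : Fin D)) (w := w + m)
        (by simp)
      have hp' := Net.scomp hcopy (hp.mono (Nat.le_add_right w m) le_rfl)
      have hn' := Net.scomp hcopy (hn.mono (Nat.le_add_right w m) le_rfl)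
      simp only [Fintype.card_fin] at hp' hn'
      have hp2 := SNet.pad hp' (by omega) (fun x => SNet.nonneg hp' (by omega) x) (2 * t + 1)
      have hn2 := SNet.pad hn' (by omega) (fun x => SNet.nonneg hn' (by omega) x) (2 * t + 1)
      refine ⟨_, _, hp2.mono (by omega) (by omega), hn2.mono (by omega) (by omega),
        fun x hx => ?_⟩
      rw [hfg x hx]
      have e : (fun j => max (x (I.orderIsoOfFin hI j : Fin D)) 0)
          = fun j => x (I.orderIsoOfFin hI j : Fin D) := by
        funext j; exact max_eq_left (hx _).1
      simp only [e]
      exact hpn _ fun j => hx _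
    · have hM := max_net t I hI (hc.trans ht)
      have hM2 := SNet.pad hM (by exact Nat.one_le_two_pow)
        (fun x => SNet.nonneg hM (by omega) x) (1 + L)
      rw [add_comm (2 * t + 1)] at hM2
      refine ⟨_, fun _ => 0, hM2.mono (by omega) (by omega),
        (SNet.zero (by omega) (1 + L + 2 * t)).mono le_rfl (by omega), fun x hx => ?_⟩
      rw [hfI x hx, max_eq_left, sub_zero, sub_self, abs_zero]
      · exact hδ
      · obtain ⟨i, hi⟩ := hI
        exact (hx i).1.trans (Finset.le_sup' (fun i => x i) hi)
  obtain ⟨p, n, hp, hn, hpn⟩ := key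
  have hpar := SNet.par (A := Bool) (w := fun b => if b then w + m + 2 ^ t else w + m)
    (L := 1 + L + (2 * t + 1)) (by omega)
    (s := fun _ => s + m + 9 * 2 ^ t + L + 2 * t + 2) (f := fun b => if b then p else n)
    (by intro b; cases b <;> simp only [if_true, Bool.false_eq_true, if_false] <;> assumption)
  refine ⟨_, Net.mono ?_ ?_ hpar, fun x hx => ?_⟩
  · simp; omega
  · simp
  · simpa using hpn x hx

lemma clamp_net {W L S D : ℕ} {F : (Fin D → ℝ) → Bool → ℝ} (hW : 1 ≤ W)
    (hF : Net W L S (Fin D) Bool F) :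
    SNet W (L + 3) (S + 6) (Fin D) (fun x => min 1 (max (F x true - F x false) 0)) := by
  have h1 := SNet.neuron0 (ι := Bool) (fun b => if b then 1 else -1)
    (by intro b; cases b <;> simp) hW
  have h2 := SNet.neuron (ι := Unit) (fun _ => -1) (-1) (by simp) (by simp) hW
  have h3 := ((hF.scomp h1).then h2).then h2
  refine Net.congr (SNet.mono h3 le_rfl (by simp)) fun x _ => ?_
  simp only [Fintype.sum_bool, if_true, Bool.false_eq_true, if_false, one_mul,
    Finset.univ_unique, Finset.sum_const, Finset.card_singleton, one_smul, neg_mul,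
    sub_neg_eq_add]
  rw [← sub_eq_add_neg]
  have hu : 0 ≤ max (F x true - F x false) 0 := le_max_right _ _
  generalize max (F x true - F x false) 0 = u at *
  rcases le_total u 1 with h | h
  · rw [min_eq_right h, max_eq_left (by linarith : 0 ≤ -u + 1), max_eq_left (by linarith)]; ring
  · rw [min_eq_left h, max_eq_right (by linarith : -u + 1 ≤ 0)]; norm_num

lemma clamp_err {v u δ : ℝ} (h0 : 0 ≤ v) (h1 : v ≤ 1) (h : |v - u| ≤ δ) :
    |v - min 1 (max u 0)| ≤ δ := by
  refine le_trans ?_ h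
  rcases le_total u 0 with hu | hu
  · rw [max_eq_right hu, min_eq_right (by norm_num), abs_of_nonneg (by linarith),
      abs_of_nonneg (by linarith)]
    linarith
  · rw [max_eq_left hu]
    rcases le_total u 1 with hu1 | hu1
    · rw [min_eq_right hu1]
    · rw [min_eq_left hu1, abs_of_nonpos (by linarith), abs_of_nonpos (by linarith)]
      linarith

lemma coord_modulus {m D dmax : ℕ} {β r C s : ℝ} (hβ : 0 < β) (hC : 1 ≤ C) (hs : 0 ≤ s)
    (hH : ∀ g, MemHolderBall m β r g → ∀ s : ℝ, 0 ≤ s → ∀ x ∈ cube m, ∀ z ∈ cube m,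
      (∀ i, |x i - z i| ≤ s) → |g x - g z| ≤ C * s ^ (min 1 β))
    {f : (Fin D → ℝ) → ℝ} (hf : GH D m β r f ∨ GM D dmax f) {x z : Fin D → ℝ}
    (hx : x ∈ cube D) (hz : z ∈ cube D) (h : ∀ i, |x i - z i| ≤ s) :
    |f x - f z| ≤ C * s ^ (min 1 β) := by
  rcases hf with ⟨I, hI, g, hg, hfg⟩ | ⟨I, hI, hc, hfI⟩
  · rw [hfg x hx, hfg z hz]
    exact hH g hg s hs _ (fun j => hx _) _ (fun j => hz _) fun j => h _
  · rw [hfI x hx, hfI z hz]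
    have hdiff : ∀ x z : Fin D → ℝ, (∀ i, |x i - z i| ≤ min s 1) →
        (I.sup' hI fun i => x i) - (I.sup' hI fun i => z i) ≤ min s 1 := by
      intro x z h
      have : (I.sup' hI fun i => x i) ≤ (I.sup' hI fun i => z i) + min s 1 := by
        refine Finset.sup'_le hI _ fun i hi => ?_
        have h1 := Finset.le_sup' (fun i => z i) hi
        have h2 := (abs_le.1 (h i)).2
        beta_reduce at h1
        linarith
      linarith
    have hh : ∀ i, |x i - z i| ≤ min s 1 := fun i => le_min (h i)
      (by rw [abs_le]; constructor <;> linarith [(hx i).1, (hx i).2, (hz i).1, (hz i).2])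
    have h1 : |(I.sup' hI fun i => x i) - (I.sup' hI fun i => z i)| ≤ min s 1 := by
      rw [abs_sub_le_iff]
      exact ⟨hdiff x z hh, hdiff z x fun i => by rw [abs_sub_comm]; exact hh i⟩
    refine h1.trans ?_
    have hθ0 : 0 < min 1 β := lt_min one_pos hβ
    have h2 : min s 1 ≤ s ^ (min 1 β) := by
      rcases le_total s 1 with h | h
      · rw [min_eq_left h]
        exact Real.self_le_rpow_of_le_one hs h (min_le_left _ _)
      · rw [min_eq_right h]
        exact Real.one_le_rpow h hθ0.le
    refine h2.trans (le_mul_of_one_le_left (Real.rpow_nonneg hs _) hC)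

/-! ### Composition -/

/-- Error recursion. -/
def eta (C θ δ : ℝ) : ℕ → ℝ
  | 0 => 0
  | (i + 1) => C * eta C θ δ i ^ θ + δ

lemma eta_nonneg {C θ δ : ℝ} (hC : 0 ≤ C) (hδ : 0 ≤ δ) (i : ℕ) : 0 ≤ eta C θ δ i := by
  induction i with
  | zero => exact le_rfl
  | succ i ih =>
    simp only [eta]
    have := Real.rpow_nonneg ih θ
    positivity

lemma eta_bound {C θ δ : ℝ} (hC : 0 ≤ C) (hθ0 : 0 < θ) (hθ1 : θ ≤ 1) (hδ0 : 0 < δ)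
    (hδ1 : δ ≤ 1) (i : ℕ) : eta C θ δ (i + 1) ≤ (C + 1) ^ i * δ ^ (θ ^ i) := by
  induction i with
  | zero => simp [eta, Real.zero_rpow hθ0.ne']
  | succ i ih =>
    have hB : 1 ≤ (C + 1) ^ i := one_le_pow₀ (by linarith)
    have hp : 0 < δ ^ (θ ^ i) := Real.rpow_pos_of_pos hδ0 _
    have h1 : eta C θ δ (i + 1) ^ θ ≤ (C + 1) ^ i * δ ^ (θ ^ (i + 1)) := by
      refine (Real.rpow_le_rpow (eta_nonneg hC hδ0.le _) ih hθ0.le).trans ?_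
      rw [Real.mul_rpow (by positivity) hp.le, ← Real.rpow_mul hδ0.le, ← pow_succ]
      refine mul_le_mul_of_nonneg_right ?_ (Real.rpow_nonneg hδ0.le _)
      exact Real.rpow_le_self_of_one_le hB hθ1
    have h2 : δ ≤ δ ^ (θ ^ (i + 1)) :=
      Real.self_le_rpow_of_le_one hδ0.le hδ1 (pow_le_one₀ hθ0.le hθ1)
    have hp' : 0 < δ ^ (θ ^ (i + 1)) := Real.rpow_pos_of_pos hδ0 _
    have h3 : δ ^ (θ ^ (i + 1)) ≤ (C + 1) ^ i * δ ^ (θ ^ (i + 1)) :=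
      le_mul_of_one_le_left hp'.le hB
    have h4 := mul_le_mul_of_nonneg_left h1 hC
    rw [eta, pow_succ (C + 1) i]
    have e : (C + 1) ^ i * (C + 1) * δ ^ θ ^ (i + 1)
        = C * ((C + 1) ^ i * δ ^ θ ^ (i + 1)) + (C + 1) ^ i * δ ^ θ ^ (i + 1) := by ring
    rw [e]
    linarith

lemma chain_net {W L S q K : ℕ} {C θ δ : ℝ} (hW : 1 ≤ W) (hK : 1 ≤ K) (hC : 0 ≤ C) (hδ : 0 ≤ δ)
    (D : ℕ → ℕ) (h : ∀ i : ℕ, (Fin (D i) → ℝ) → (Fin (D (i + 1)) → ℝ))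
    (hDK : ∀ i : ℕ, 1 ≤ i → i ≤ q → D i = K)
    (hcoord : ∀ i, i ≤ q → ∀ j, ∃ F : (Fin (D i) → ℝ) → Bool → ℝ,
      Net W L S (Fin (D i)) Bool F ∧ ∀ x ∈ cube (D i), |h i x j - (F x true - F x false)| ≤ δ)
    (hmod : ∀ i, i ≤ q → ∀ j, ∀ s : ℝ, 0 ≤ s → ∀ x ∈ cube (D i), ∀ z ∈ cube (D i),
      (∀ l, |x l - z l| ≤ s) → |h i x j - h i z j| ≤ C * s ^ θ)
    (hcube : ∀ i : ℕ, i < q → ∀ x ∈ cube (D i), h i x ∈ cube (D (i + 1))) :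
    ∀ i, i ≤ q → ∃ F : (Fin (D 0) → ℝ) → Fin (D i) → ℝ,
      Net (K * W) (i * (L + 3)) (i * (K * (S + 6))) (Fin (D 0)) (Fin (D i)) F ∧
      ∀ x ∈ cube (D 0), depChain D h i x ∈ cube (D i) ∧ F x ∈ cube (D i) ∧
        ∀ j, |depChain D h i x j - F x j| ≤ eta C θ δ i := by
  intro i
  induction i with
  | zero =>
    intro _
    rw [zero_mul, zero_mul]
    refine ⟨fun x => x, ⟨Equiv.refl _, fun _ _ => rfl⟩, fun x hx => ⟨hx, hx, fun j => ?_⟩⟩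
    simp [depChain, eta]
  | succ i ih =>
    intro hi
    obtain ⟨F, hF, hFx⟩ := ih (by omega)
    choose G hG hGx using hcoord i (by omega)
    have hcl := fun j => clamp_net hW (hG j)
    have hpar := SNet.par (by omega) hcl
    simp only [Finset.sum_const, Finset.card_univ, Fintype.card_fin, smul_eq_mul] at hpar
    have hDi : D (i + 1) = K := hDK (i + 1) (by omega) hi
    have hcomp := hF.comp (Net.mono (le_of_eq (by rw [hDi])) (le_of_eq (by rw [hDi])) hpar
      : Net (K * W) (L + 3) (K * (S + 6)) _ _ _)
    rw [show (i + 1) * (L + 3) = i * (L + 3) + (L + 3) by ring,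
      show (i + 1) * (K * (S + 6)) = i * (K * (S + 6)) + K * (S + 6) by ring]
    refine ⟨_, hcomp, fun x hx => ?_⟩
    obtain ⟨h1, h2, h3⟩ := hFx x hx
    have h4 := hcube i (by omega) _ h1
    refine ⟨h4, fun j => ⟨le_min zero_le_one (le_max_right _ _), min_le_left _ _⟩, fun j => ?_⟩
    have h5 := hmod i (by omega) j _ (eta_nonneg hC hδ i) _ h1 _ h2 h3
    have h6 := hcube i (by omega) _ h2 j
    have h7 := clamp_err h6.1 h6.2 (hGx j _ h2)
    have := abs_sub_le (h i (depChain D h i x) j) (h i (F x) j)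
      (min 1 (max (G j (F x) true - G j (F x) false) 0))
    simp only [depChain, eta]
    linarith

lemma comp_net {W L S q K : ℕ} {C θ δ : ℝ} (hW : 1 ≤ W) (hK : 1 ≤ K) (hL : 1 ≤ L)
    (hC : 0 ≤ C) (hδ : 0 ≤ δ)
    (D : ℕ → ℕ) (h : ∀ i : ℕ, (Fin (D i) → ℝ) → (Fin (D (i + 1)) → ℝ))
    (hDK : ∀ i : ℕ, 1 ≤ i → i ≤ q → D i = K)
    (hcoord : ∀ i, i ≤ q → ∀ j, ∃ F : (Fin (D i) → ℝ) → Bool → ℝ,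
      Net W L S (Fin (D i)) Bool F ∧ ∀ x ∈ cube (D i), |h i x j - (F x true - F x false)| ≤ δ)
    (hmod : ∀ i, i ≤ q → ∀ j, ∀ s : ℝ, 0 ≤ s → ∀ x ∈ cube (D i), ∀ z ∈ cube (D i),
      (∀ l, |x l - z l| ≤ s) → |h i x j - h i z j| ≤ C * s ^ θ)
    (hcube : ∀ i : ℕ, i < q → ∀ x ∈ cube (D i), h i x ∈ cube (D (i + 1)))
    (j : Fin (D (q + 1))) {G N Sr : ℝ} (hG : ((q : ℝ) + 1) * ((L + 3 : ℕ) : ℝ) ≤ G)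
    (hN : (K : ℝ) * W ≤ N) (hS : ((K : ℝ) * q + 1) * ((S + 6 : ℕ) : ℝ) ≤ Sr) :
    ∃ ft : (Fin (D 0) → ℝ) → ℝ, IsFNN (D 0) G N Sr 1 ⊤ ft ∧
      ∀ x ∈ cube (D 0), |depChain D h (q + 1) x j - ft x| ≤ eta C θ δ (q + 1) := by
  obtain ⟨F, hF, hFx⟩ := chain_net hW hK hC hδ D h hDK hcoord hmod hcube q le_rfl
  obtain ⟨H, hH, hHx⟩ := hcoord q le_rfl j
  have hcomp := hF.comp (Net.mono (Nat.le_mul_of_pos_left W hK) le_rfl hH)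
  have hfnn := Net.isFNN hcomp (by omega) (fun b => if b then 1 else -1)
    (by intro b; cases b <;> simp) (G := G) (N := N) (S := Sr) ?_ ?_ ?_
  · refine ⟨_, hfnn, fun x hx => ?_⟩
    obtain ⟨h1, h2, h3⟩ := hFx x hx
    have h5 := hmod q le_rfl j _ (eta_nonneg hC hδ q) _ h1 _ h2 h3
    have h7 := hHx _ h2
    have := abs_sub_le (h q (depChain D h q x) j) (h q (F x) j) (H (F x) true - H (F x) false)
    simp only [depChain, eta, Fintype.sum_bool, if_true, Bool.false_eq_true, if_false, one_mul,
      neg_mul, ← sub_eq_add_neg]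
    linarith
  · refine le_trans ?_ hG
    push_cast
    nlinarith
  · refine le_trans ?_ hN
    push_cast
    exact le_rfl
  · refine le_trans ?_ hS
    simp only [Fintype.card_bool]
    push_cast
    nlinarith


lemma delta_facts {m : ℕ} {β M T : ℝ} (hβ : 0 < β) (hM : 8 ≤ M) (hT0 : 0 < T) (hT1 : T ≤ 1) :
    ∃ cp cl : ℝ, 0 < cp ∧ 0 < cl ∧ ∀ ε : ℝ, 0 < ε → ε ≤ 1 / 2 → ∃ δ : ℝ, 0 < δ ∧ δ ≤ 1 / 2 ∧
      M * δ ^ T = ε ∧ δ ^ (-((m : ℝ) / β)) = cp * ε ^ (-((m : ℝ) / (β * T))) ∧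
      Real.log (1 / δ) ≤ cl * Real.log (1 / ε) := by
  have hM0 : 0 < M := by linarith
  have hlM : 0 ≤ Real.log M := Real.log_nonneg (by linarith)
  refine ⟨M ^ ((m : ℝ) / (β * T)), (1 / T) * (2 * Real.log M + 1), by positivity, by positivity,
    fun ε h0 h1 => ⟨(ε / M) ^ (1 / T), by positivity, ?_, ?_, ?_, ?_⟩⟩
  · have hle : ε / M ≤ 1 / 2 := by
      rw [div_le_iff₀ hM0]; nlinarith
    refine le_trans (Real.rpow_le_self_of_le_one (by positivity) (by linarith) ?_) hle
    rw [le_div_iff₀ hT0]; linarith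
  · rw [← Real.rpow_mul (by positivity), one_div, inv_mul_cancel₀ hT0.ne', Real.rpow_one]
    field_simp
  · rw [← Real.rpow_mul (by positivity)]
    have : 1 / T * -((m : ℝ) / β) = -((m : ℝ) / (β * T)) := by field_simp
    rw [this, Real.div_rpow h0.le hM0.le, Real.rpow_neg hM0.le]
    field_simp
  · have hl := log_inv_ge h0 h1
    rw [one_div, Real.log_inv, Real.log_rpow (by positivity), Real.log_div h0.ne' hM0.ne']
    have h2 : Real.log (1 / ε) = - Real.log ε := by rw [one_div, Real.log_inv]
    rw [h2] at hl ⊢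
    have hT : 0 < 1 / T := by positivity
    have : Real.log M - Real.log ε ≤ (2 * Real.log M + 1) * (- Real.log ε) := by nlinarith
    nlinarith [mul_le_mul_of_nonneg_left this hT.le]

lemma dyadic {n : ℕ} (hn : 0 < n) : ∃ k : ℕ, n ≤ 2 ^ (k + 1) ∧ 2 ^ (k + 1) ≤ 2 * n ∧
    2 * (k : ℝ) ≤ 3 * Real.log (n : ℝ) := by
  obtain ⟨k, h1, h2⟩ := exists_nat_pow_near (x := n) (y := 2) hn (by norm_num)
  refine ⟨k, h2.le, by rw [pow_succ]; omega, ?_⟩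
  have h3 : (k : ℝ) * Real.log 2 ≤ Real.log n := by
    rw [← Real.log_pow]
    exact Real.log_le_log (by positivity) (by exact_mod_cast h1)
  have := Real.log_two_gt_d9
  have hk : (0 : ℝ) ≤ k := Nat.cast_nonneg k
  nlinarith

set_option maxHeartbeats 1000000 in
/-- Lemma: ReLU network approximation of functions in `G^CHOM`. -/
theorem statement15 (β r : ℝ) (hβ : 0 < β) (hr : 0 < r) (q dstar : ℕ) (hdstar : 0 < dstar) :
    ∃ E₇ : ℝ, 0 < E₇ ∧
      ∀ (d dmax K : ℕ), 0 < d → 0 < dmax → 0 < K →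
        (dstar : ℤ) ≤ min (d : ℤ) ((K : ℤ) + (if q = 0 then 1 else 0) * ((d : ℤ) - (K : ℤ))) →
      ∀ f : (Fin d → ℝ) → ℝ, GCHOM q d dmax dstar K β r f →
      ∀ ε : ℝ, ε ∈ Set.Ioc (0 : ℝ) (1 / 2) →
        ∃ ft : (Fin d → ℝ) → ℝ,
          IsFNN d (((q : ℝ) + 1) * (3 * Real.log (dmax : ℝ) + E₇ * Real.log (1 / ε)))
            (2 * (K : ℝ) * (dmax : ℝ)
              + (K : ℝ) * E₇ * ε ^ (-((dstar : ℝ) / (β * (min 1 β) ^ q))))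
            (((K : ℝ) * (q : ℝ) + 1) * (63 * (dmax : ℝ)
              + E₇ * ε ^ (-((dstar : ℝ) / (β * (min 1 β) ^ q))) * Real.log (1 / ε)))
            1 ⊤ ft ∧
          ∀ x ∈ cube d, |f x - ft x| ≤ ε / 8 := by
  obtain ⟨CH, hCH, hnet⟩ := holder_net dstar hdstar β r hβ hr
  obtain ⟨CM, hCM, hmodulus⟩ := holder_modulus dstar hdstar β r hβ hr
  have hθ0 : 0 < min 1 β := lt_min one_pos hβ
  have hθ1 : min 1 β ≤ 1 := min_le_left _ _
  have hT0 : 0 < (min 1 β) ^ q := pow_pos hθ0 q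
  have hT1 : (min 1 β) ^ q ≤ 1 := pow_le_one₀ hθ0.le hθ1
  have hC1 : 1 ≤ max 1 CM := le_max_left _ _
  have hB : 1 ≤ (max 1 CM + 1) ^ q := one_le_pow₀ (by linarith)
  obtain ⟨cp, cl, hcp, hcl, hdelta⟩ := delta_facts (m := dstar) (M := 8 * (max 1 CM + 1) ^ q)
    (T := (min 1 β) ^ q) hβ (by linarith) hT0 hT1
  have hm0 : (0 : ℝ) ≤ dstar := Nat.cast_nonneg _
  have hA : 0 < CH * cl := by positivity
  have hB' : 0 < CH * cp := by positivity
  have hC' : 0 < CH * cp * cl := by positivity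
  refine ⟨(CH * cl + 14) + (2 * (CH * cp) + 2 * dstar)
    + (2 * (CH * cp * cl) + 4 * dstar + 2 * (CH * cl) + 20), by positivity, ?_⟩
  intro d dmax K hd hdmax hK _ f hf ε hε
  obtain ⟨D, h, hD0, hDq, hDK, hGH, hcube, hf⟩ := hf
  subst hD0
  obtain ⟨δ, hδ0, hδ1, hδT, hδp, hδl⟩ := hdelta ε hε.1 hε.2
  obtain ⟨w, L, s, hw, hL, hLb, hwb, hsb, hg⟩ := hnet δ hδ0 hδ1
  obtain ⟨n, hn1, hn2, hn3⟩ := dyadic hdmax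
  have hl := log_inv_ge hε.1 hε.2
  have hP := rpow_neg_ge (a := (dstar : ℝ) / (β * (min 1 β) ^ q)) hε.1 hε.2 (by positivity)
  rw [hδp] at hwb hsb
  generalize ε ^ (-((dstar : ℝ) / (β * (min 1 β) ^ q))) = P at *
  generalize hℓ : Real.log (1 / ε) = ℓ at *
  have hlogδ : 0 ≤ Real.log (1 / δ) := by have := log_inv_ge hδ0 hδ1; linarith
  have hL2 : (L : ℝ) ≤ CH * cl * ℓ := by
    have := mul_le_mul_of_nonneg_left hδl hCH.le
    linarith
  have hw2 : (w : ℝ) ≤ CH * cp * P := by linarith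
  have hs2 : (s : ℝ) ≤ CH * cp * cl * (P * ℓ) := by
    have h0 : 0 ≤ CH * (cp * P) := by positivity
    have := mul_le_mul_of_nonneg_left hδl h0
    nlinarith
  have hPl1 : ℓ ≤ P * ℓ := by nlinarith
  have hPl2 : 1 / 2 ≤ P * ℓ := by linarith
  have hK1 : (1 : ℝ) ≤ K := by exact_mod_cast hK
  have hn2' : (2 : ℝ) ^ (n + 1) ≤ 2 * dmax := by exact_mod_cast hn2
  have htt : (n : ℝ) + 1 ≤ 2 * dmax := by
    have : n + 1 < 2 ^ (n + 1) := Nat.lt_two_pow_self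
    have : n + 1 ≤ 2 * dmax := by omega
    exact_mod_cast this
  have hPℓ0 : 0 ≤ P * ℓ := by linarith
  obtain ⟨ft, hft, hfx⟩ := comp_net (W := 2 * (w + dstar) + 2 ^ (n + 1))
    (L := 1 + L + (2 * (n + 1) + 1))
    (S := 2 * (s + dstar + 9 * 2 ^ (n + 1) + L + 2 * (n + 1) + 2)) (q := q) (K := K)
    (C := max 1 CM) (θ := min 1 β) (δ := δ)
    (G := ((q : ℝ) + 1) * (3 * Real.log (dmax : ℝ) + ((CH * cl + 14) + (2 * (CH * cp) + 2 * dstar)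
    + (2 * (CH * cp * cl) + 4 * dstar + 2 * (CH * cl) + 20)) * ℓ))
    (N := 2 * (K : ℝ) * (dmax : ℝ)
              + (K : ℝ) * ((CH * cl + 14) + (2 * (CH * cp) + 2 * dstar)
    + (2 * (CH * cp * cl) + 4 * dstar + 2 * (CH * cl) + 20)) * P)
    (Sr := ((K : ℝ) * (q : ℝ) + 1) * (63 * (dmax : ℝ)
              + ((CH * cl + 14) + (2 * (CH * cp) + 2 * dstar)
    + (2 * (CH * cp * cl) + 4 * dstar + 2 * (CH * cl) + 20)) * P * ℓ))
    (by omega) hK (by omega) (by linarith) hδ0.le D h hDK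
    (fun i hi j => coord_net hw hL hδ0.le hg hn1 (hGH i hi j))
    (fun i hi j s hs x hx z hz hxz => coord_modulus hβ hC1 hs
      (fun g hg s hs x hx z hz hxz => (hmodulus g hg s hs x hx z hz hxz).trans
        (mul_le_mul_of_nonneg_right (le_max_right _ _) (Real.rpow_nonneg hs _)))
      (hGH i hi j) hx hz hxz)
    hcube (Fin.cast hDq.symm 0)
    (by
      refine mul_le_mul_of_nonneg_left ?_ (by positivity)
      push_cast
      have h1 : 0 ≤ ((2 * (CH * cp) + 2 * dstar)
        + (2 * (CH * cp * cl) + 4 * dstar + 2 * (CH * cl) + 20)) * ℓ := by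
        apply mul_nonneg <;> [positivity; linarith]
      nlinarith)
    (by
      have h2 : ((2 * (w + dstar) + 2 ^ (n + 1) : ℕ) : ℝ) ≤ 2 * dmax + ((CH * cl + 14)
        + (2 * (CH * cp) + 2 * dstar)
        + (2 * (CH * cp * cl) + 4 * dstar + 2 * (CH * cl) + 20)) * P := by
        push_cast
        have h1 : 0 ≤ ((CH * cl + 14)
          + (2 * (CH * cp * cl) + 4 * dstar + 2 * (CH * cl) + 20)) * P := by
          apply mul_nonneg <;> [positivity; linarith]
        have h3 : (dstar : ℝ) ≤ dstar * P := le_mul_of_one_le_right hm0 hP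
        nlinarith
      have := mul_le_mul_of_nonneg_left h2 (by linarith : (0 : ℝ) ≤ K)
      linarith)
    (by
      refine mul_le_mul_of_nonneg_left ?_ (by positivity)
      push_cast
      have h1 : 0 ≤ ((CH * cl + 14) + (2 * (CH * cp) + 2 * dstar)) * (P * ℓ) := by
        apply mul_nonneg <;> [positivity; linarith]
      have h3 : (dstar : ℝ) * (1 / 2) ≤ dstar * (P * ℓ) := mul_le_mul_of_nonneg_left hPl2 hm0
      have h4 : CH * cl * ℓ ≤ CH * cl * (P * ℓ) := mul_le_mul_of_nonneg_left hPl1 hA.le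
      nlinarith)
  refine ⟨ft, hft, fun x hx => ?_⟩
  rw [hf x hx]
  refine (hfx x hx).trans ((eta_bound (by linarith) hθ0 hθ1 hδ0 (by linarith) q).trans ?_)
  linarith


end

end DNNLogistic
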